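/- Global inclusion of anisotropic Hölder space into kinetic Hölder space (Corollary 1.8(i)). Let d ≥ 1, α ∈ (0,1), T ∈ (−∞,∞]. Then every u ∈ ℂ^{2,α}(ℝ^{1+2d}_T) belongs to kC^{2,α}(ℝ^{1+2d}_T), and there is N = N(d,α) > 0 such that [D²_v u]_{kC^α(ℝ^{1+2d}_T)} ≤ N ( [∂_t u − v·D_x u]_{L∞C^{α/3,α}_{x,v}(ℝ^{1+2d}_T)} + [Δ_v u]_{L∞C^{α/3,α}_{x,v}(ℝ^{1+2d}_T)} ). -/

import Mathlib

open MeasureTheory ENNReal Set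

noncomputable section

/-- Euclidean space `ℝ^d`. -/
abbrev Ed (d : ℕ) : Type := EuclideanSpace ℝ (Fin d)

/-- Points `z = (t, x, v) ∈ ℝ × ℝ^d × ℝ^d`. -/
abbrev Pt (d : ℕ) : Type := ℝ × Ed d × Ed d

/-- The kinetic quasi-distance `ρ(z, z₀)`. -/
def kRho {d : ℕ} (z z0 : Pt d) : ℝ :=
  max (|z.1 - z0.1| ^ ((1 : ℝ)/2))
    (max (‖z.2.1 - z0.2.1 + (z.1 - z0.1) • z0.2.2‖ ^ ((1 : ℝ)/3)) ‖z.2.2 - z0.2.2‖)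

/-- The kinetic Hölder seminorm `[u]_{kC^α(G)}` (extended-real valued). -/
def kSemi {d : ℕ} {F : Type*} [NormedAddCommGroup F] (α : ℝ) (G : Set (Pt d))
    (u : Pt d → F) : ℝ≥0∞ :=
  ⨆ (z : Pt d) (_ : z ∈ G) (z' : Pt d) (_ : z' ∈ G) (_ : z ≠ z'),
    ENNReal.ofReal (‖u z - u z'‖ / kRho z z' ^ α)

/-- The sup (`L_∞`) norm over `G`, extended-real valued. -/
def supNorm {d : ℕ} {F : Type*} [NormedAddCommGroup F] (G : Set (Pt d))
    (u : Pt d → F) : ℝ≥0∞ :=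
  ⨆ (z : Pt d) (_ : z ∈ G), (‖u z‖₊ : ℝ≥0∞)

/-- Anisotropic Hölder seminorm `[w]_{C^{α/3,α}_{x,v}(D)}`. -/
def anisoSemi {d : ℕ} {F : Type*} [NormedAddCommGroup F] (α : ℝ) (D : Set (Ed d × Ed d))
    (w : Ed d × Ed d → F) : ℝ≥0∞ :=
  ⨆ (p : Ed d × Ed d) (_ : p ∈ D) (q : Ed d × Ed d) (_ : q ∈ D) (_ : p ≠ q),
    ENNReal.ofReal (‖w p - w q‖ / (‖p.1 - q.1‖ ^ ((1 : ℝ)/3) + ‖p.2 - q.2‖) ^ α)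

/-- The `L_∞ C^{α/3,α}_{x,v}` seminorm over `I × D`. -/
def lixvSemi {d : ℕ} {F : Type*} [NormedAddCommGroup F] (α : ℝ) (I : Set ℝ)
    (D : Set (Ed d × Ed d)) (u : Pt d → F) : ℝ≥0∞ :=
  ⨆ (t : ℝ) (_ : t ∈ I), anisoSemi α D (fun p => u (t, p.1, p.2))

/-- The time interval `(−∞, T)` for `T ∈ (−∞, ∞]`. -/
def slabI (T : EReal) : Set ℝ := {t : ℝ | (t : EReal) < T}

/-- The set `ℝ^{1+2d}_T = (−∞,T) × ℝ^{2d}`. -/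
def slabG (d : ℕ) (T : EReal) : Set (Pt d) := slabI T ×ˢ (Set.univ : Set (Ed d × Ed d))

/-- Classical time derivative `∂_t u`. -/
def Dt {d : ℕ} (u : Pt d → ℝ) (z : Pt d) : ℝ := deriv (fun s => u (s, z.2.1, z.2.2)) z.1

/-- Classical spatial gradient `D_x u`. -/
def Dx {d : ℕ} (u : Pt d → ℝ) (z : Pt d) : Ed d →L[ℝ] ℝ :=
  fderiv ℝ (fun y => u (z.1, y, z.2.2)) z.2.1

/-- Classical velocity gradient `D_v u`. -/
def Dv {d : ℕ} (u : Pt d → ℝ) (z : Pt d) : Ed d →L[ℝ] ℝ :=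
  fderiv ℝ (fun w => u (z.1, z.2.1, w)) z.2.2

/-- Classical velocity Hessian `D²_v u`. -/
def Dvv {d : ℕ} (u : Pt d → ℝ) (z : Pt d) : Ed d →L[ℝ] Ed d →L[ℝ] ℝ :=
  fderiv ℝ (fun w => Dv u (z.1, z.2.1, w)) z.2.2

/-- Transport term `Y u = ∂_t u − v · D_x u`. -/
def Yop {d : ℕ} (u : Pt d → ℝ) (z : Pt d) : ℝ := Dt u z - Dx u z z.2.2

/-- Contraction `a^{ij} B_{ij}`. -/
def contr2 {d : ℕ} (A : Matrix (Fin d) (Fin d) ℝ) (B : Ed d →L[ℝ] Ed d →L[ℝ] ℝ) : ℝ :=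
  ∑ i, ∑ j, A i j * B (EuclideanSpace.single i 1) (EuclideanSpace.single j 1)

/-- KFP operator `P u = ∂_t u − v·D_x u − a^{ij}(z) D_{v_iv_j} u`. -/
def Pop {d : ℕ} (a : Pt d → Matrix (Fin d) (Fin d) ℝ) (u : Pt d → ℝ) (z : Pt d) : ℝ :=
  Yop u z - contr2 (a z) (Dvv u z)

/-- Model KFP operator with `a = a(t)`. -/
def P0op {d : ℕ} (a : ℝ → Matrix (Fin d) (Fin d) ℝ) (u : Pt d → ℝ) (z : Pt d) : ℝ :=
  Yop u z - contr2 (a z.1) (Dvv u z)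

/-- Laplacian in the velocity variable `Δ_v u`. -/
def lapV {d : ℕ} (u : Pt d → ℝ) (z : Pt d) : ℝ :=
  ∑ i, Dvv u z (EuclideanSpace.single i 1) (EuclideanSpace.single i 1)

/-- Fractional Laplacian `(−Δ_x)^{1/3} u`, pointwise integral formula with constant `cd`. -/
def fracLap {d : ℕ} (cd : ℝ) (u : Pt d → ℝ) (z : Pt d) : ℝ :=
  cd * ∫ y : Ed d, (u z - u (z.1, z.2.1 + y, z.2.2)) / ‖y‖ ^ ((d : ℝ) + 2/3)

/-- Hölder seminorm in `x` of a function on `ℝ^d`. -/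
def xSemi {d : ℕ} (β : ℝ) (w : Ed d → ℝ) : ℝ≥0∞ :=
  ⨆ (x : Ed d) (x' : Ed d) (_ : x ≠ x'), ENNReal.ofReal (|w x - w x'| / ‖x - x'‖ ^ β)

/-- `sup_{t ∈ I, v} [u(t,·,v)]_{C^β(ℝ^d)}`. -/
def supXSemi {d : ℕ} (β : ℝ) (I : Set ℝ) (u : Pt d → ℝ) : ℝ≥0∞ :=
  ⨆ (t : ℝ) (_ : t ∈ I) (v : Ed d), xSemi β (fun x => u (t, x, v))

/-- Hölder norm in `x` over a set `A ⊂ ℝ^d`. -/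
def xHolderNorm {d : ℕ} (β : ℝ) (A : Set (Ed d)) (w : Ed d → ℝ) : ℝ≥0∞ :=
  (⨆ (x : Ed d) (_ : x ∈ A), ENNReal.ofReal |w x|) +
    ⨆ (x : Ed d) (_ : x ∈ A) (x' : Ed d) (_ : x' ∈ A) (_ : x ≠ x'),
      ENNReal.ofReal (|w x - w x'| / ‖x - x'‖ ^ β)

/-- Kinetic cylinder `Q_{r,s}(z₀)` (`v`-radius `r`, `x`-radius `s³`). -/
def kCyl {d : ℕ} (r s : ℝ) (z0 : Pt d) : Set (Pt d) :=
  {z : Pt d | z0.1 - r ^ 2 < z.1 ∧ z.1 < z0.1 ∧ ‖z.2.2 - z0.2.2‖ < r ∧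
    ‖z.2.1 - z0.2.1 + (z.1 - z0.1) • z0.2.2‖ < s ^ 3}

/-- Kinetic cylinder `Q_r(z₀)`. -/
def kQ {d : ℕ} (r : ℝ) (z0 : Pt d) : Set (Pt d) := kCyl r r z0

/-- The origin of `ℝ^{1+2d}`. -/
def ptO (d : ℕ) : Pt d := (0, 0, 0)

/-- Mean-square average `(|g|²)^{1/2}_A`. -/
def msq {d : ℕ} {F : Type*} [NormedAddCommGroup F] (A : Set (Pt d)) (g : Pt d → F) : ℝ :=
  Real.sqrt (⨍ z in A, ‖g z‖ ^ 2)

/-- Average `(g)_A`. -/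
def avg {d : ℕ} {F : Type*} [NormedAddCommGroup F] [NormedSpace ℝ F] (A : Set (Pt d))
    (g : Pt d → F) : F :=
  ⨍ z in A, g z

/-- Mean-square oscillation `(|g − (g)_A|²)^{1/2}_A`. -/
def oscL2 {d : ℕ} {F : Type*} [NormedAddCommGroup F] [NormedSpace ℝ F] (A : Set (Pt d))
    (g : Pt d → F) : ℝ :=
  msq A (fun z => g z - avg A g)

/-- `L²` norm over `A`. -/
def l2 {d : ℕ} {F : Type*} [NormedAddCommGroup F] (A : Set (Pt d)) (g : Pt d → F) : ℝ :=
  Real.sqrt (∫ z in A, ‖g z‖ ^ 2)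

/-- Membership in the kinetic Hölder space `kC^{2,α}(I × D)`:
`u ∈ kC^α`, the classical derivatives `D_v u`, `D²_v u`, `Y u` exist,
`Y u ∈ L_∞ C^{α/3,α}_{x,v}` and `[D²_v u]_{kC^α} < ∞`. -/
def kC2mem {d : ℕ} (α : ℝ) (I : Set ℝ) (D : Set (Ed d × Ed d)) (u : Pt d → ℝ) : Prop :=
  supNorm (I ×ˢ D) u < ⊤ ∧ kSemi α (I ×ˢ D) u < ⊤ ∧
  (∀ z ∈ I ×ˢ D, DifferentiableAt ℝ (fun s => u (s, z.2.1, z.2.2)) z.1) ∧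
  (∀ z ∈ I ×ˢ D, DifferentiableAt ℝ (fun y => u (z.1, y, z.2.2)) z.2.1) ∧
  (∀ z ∈ I ×ˢ D, DifferentiableAt ℝ (fun w => u (z.1, z.2.1, w)) z.2.2) ∧
  (∀ z ∈ I ×ˢ D, DifferentiableAt ℝ (fun w => Dv u (z.1, z.2.1, w)) z.2.2) ∧
  supNorm (I ×ˢ D) (Yop u) < ⊤ ∧
  lixvSemi α I D (Yop u) < ⊤ ∧
  kSemi α (I ×ˢ D) (Dvv u) < ⊤

/-- Membership in the anisotropic Hölder space `ℂ^{2,α}(I × D)`: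
the classical derivatives `D_v u`, `D²_v u`, `Y u` exist and
`u, D_v u, D²_v u, Y u ∈ L_∞ C^{α/3,α}_{x,v}(I × D)`. -/
def C2mem {d : ℕ} (α : ℝ) (I : Set ℝ) (D : Set (Ed d × Ed d)) (u : Pt d → ℝ) : Prop :=
  (∀ z ∈ I ×ˢ D, DifferentiableAt ℝ (fun s => u (s, z.2.1, z.2.2)) z.1) ∧
  (∀ z ∈ I ×ˢ D, DifferentiableAt ℝ (fun y => u (z.1, y, z.2.2)) z.2.1) ∧
  (∀ z ∈ I ×ˢ D, DifferentiableAt ℝ (fun w => u (z.1, z.2.1, w)) z.2.2) ∧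
  (∀ z ∈ I ×ˢ D, DifferentiableAt ℝ (fun w => Dv u (z.1, z.2.1, w)) z.2.2) ∧
  supNorm (I ×ˢ D) u < ⊤ ∧ lixvSemi α I D u < ⊤ ∧
  supNorm (I ×ˢ D) (Dv u) < ⊤ ∧ lixvSemi α I D (Dv u) < ⊤ ∧
  supNorm (I ×ˢ D) (Dvv u) < ⊤ ∧ lixvSemi α I D (Dvv u) < ⊤ ∧
  supNorm (I ×ˢ D) (Yop u) < ⊤ ∧ lixvSemi α I D (Yop u) < ⊤

/-- Ellipticity and boundedness of a coefficient matrix: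
`a^{ij} ξ_i ξ_j ≥ δ|ξ|²` and `|a| ≤ δ⁻¹`. -/
def elliptic {d : ℕ} (δ : ℝ) (A : Matrix (Fin d) (Fin d) ℝ) : Prop :=
  (∀ ξ : Ed d, δ * ‖ξ‖ ^ 2 ≤ ∑ i, ∑ j, A i j * ξ i * ξ j) ∧ (∀ i j, |A i j| ≤ δ⁻¹)

/-- Iterated classical mixed derivative `D_v^m D_x^l u`. -/
def Dmix {d : ℕ} (l m : ℕ) (u : Pt d → ℝ) (z : Pt d) :
    ContinuousMultilinearMap ℝ (fun _ : Fin m => Ed d)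
      (ContinuousMultilinearMap ℝ (fun _ : Fin l => Ed d) ℝ) :=
  iteratedFDeriv ℝ m (fun w => iteratedFDeriv ℝ l (fun y => u (z.1, y, w)) z.2.1) z.2.2

/-- Time derivative of the mixed derivative: `∂_t D_x^l D_v^m u`. -/
def DtMix {d : ℕ} (l m : ℕ) (u : Pt d → ℝ) (z : Pt d) :
    ContinuousMultilinearMap ℝ (fun _ : Fin m => Ed d)
      (ContinuousMultilinearMap ℝ (fun _ : Fin l => Ed d) ℝ) :=
  deriv (fun s => Dmix l m u (s, z.2.1, z.2.2)) z.1

/-- `∂_t` for functions of `(t,v)`. -/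
def Dt2 {d : ℕ} (w : ℝ × Ed d → ℝ) (t : ℝ) (v : Ed d) : ℝ := deriv (fun s => w (s, v)) t

/-- `D_v` for functions of `(t,v)`. -/
def Dv2 {d : ℕ} (w : ℝ × Ed d → ℝ) (t : ℝ) (v : Ed d) : Ed d →L[ℝ] ℝ :=
  fderiv ℝ (fun y => w (t, y)) v

/-- `D²_v` for functions of `(t,v)`. -/
def Dvv2 {d : ℕ} (w : ℝ × Ed d → ℝ) (t : ℝ) (v : Ed d) : Ed d →L[ℝ] Ed d →L[ℝ] ℝ :=
  fderiv ℝ (fun y => Dv2 w t y) v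

/-- The kinetic scaling `z ↦ z̃ = (r²t + t₀, r³x + x₀ − r²t v₀, rv + v₀)`. -/
def kScale {d : ℕ} (r : ℝ) (z0 z : Pt d) : Pt d :=
  (r ^ 2 * z.1 + z0.1, (r ^ 3) • z.2.1 + z0.2.1 - (r ^ 2 * z.1) • z0.2.2, r • z.2.2 + z0.2.2)

/-- Kinetic Campanato seminorm. -/
def campSemi {d : ℕ} (α : ℝ) (T : EReal) (u : Pt d → ℝ) : ℝ≥0∞ :=
  ⨆ (r : ℝ) (_ : 0 < r) (z0 : Pt d) (_ : (z0.1 : EReal) ≤ T),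
    ENNReal.ofReal (oscL2 (kQ r z0) u / r ^ α)

end

section

open Filter Topology

lemma tendsto_symm_second_diff {g g' : ℝ → ℝ} {g'' : ℝ}
    (hg : ∀ᶠ s in 𝓝 0, HasDerivAt g (g' s) s) (hg' : HasDerivAt g' g'' 0) :
    Tendsto (fun s => (g s + g (-s) - 2 * g 0) / s ^ 2) (𝓝[≠] 0) (𝓝 g'') := by
  have hneg : ∀ᶠ s in 𝓝 (0:ℝ), HasDerivAt g (g' (-s)) (-s) := by
    have : Tendsto (fun s : ℝ => -s) (𝓝 0) (𝓝 0) := by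
      simpa using (continuous_neg (G := ℝ)).tendsto 0
    exact this.eventually hg
  have hc : ContinuousAt g 0 := hg.self_of_nhds.continuousAt
  refine HasDerivAt.lhopital_zero_nhdsNE (f' := fun s => g' s - g' (-s)) (g' := fun s => 2 * s)
    ?_ ?_ ?_ ?_ ?_ ?_
  · filter_upwards [hg.filter_mono nhdsWithin_le_nhds, hneg.filter_mono nhdsWithin_le_nhds]
      with s h1 h2
    have h3 : HasDerivAt (fun s => g (-s)) (g' (-s) * (-1)) s :=
      HasDerivAt.comp s h2 (hasDerivAt_neg s)
    simpa [sub_eq_add_neg] using (h1.add h3).sub_const (2 * g 0)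
  · filter_upwards with s
    simpa using hasDerivAt_pow 2 s
  · filter_upwards [self_mem_nhdsWithin] with s hs
    simpa using hs
  · have h1 : ContinuousAt (fun s => g s + g (-s) - 2 * g 0) 0 := by
      refine (hc.add (ContinuousAt.comp (f := fun s : ℝ => -s) ?_ continuous_neg.continuousAt)).sub
        continuousAt_const
      simpa using hc
    have := h1.tendsto.mono_left (nhdsWithin_le_nhds (s := {(0:ℝ)}ᶜ))
    convert this using 2
    simp; ring
  · have : Tendsto (fun s : ℝ => s ^ 2) (𝓝 0) (𝓝 (0 ^ 2)) := (continuous_pow 2).tendsto 0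
    simpa using this.mono_left (nhdsWithin_le_nhds (s := {(0:ℝ)}ᶜ))
  · have h1 : HasDerivAt (fun s => g' (-s)) (g'' * (-1)) 0 := by
      refine HasDerivAt.comp (0:ℝ) ?_ (hasDerivAt_neg 0)
      simpa using hg'
    have h2 := (hg'.sub h1).tendsto_slope
    have h3 := h2.div_const 2
    convert h3 using 2 with s
    · simp [slope_def_field]
      field_simp
    · ring

lemma tendsto_second_diff_fderiv {E : Type*} [NormedAddCommGroup E] [NormedSpace ℝ E] {f : E → ℝ}
    (hf : Differentiable ℝ f) (hf' : Differentiable ℝ (fderiv ℝ f)) (p b : E) :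
    Tendsto (fun s : ℝ => (f (p + s • b) + f (p - s • b) - 2 * f p) / s ^ 2) (𝓝[≠] 0)
      (𝓝 (fderiv ℝ (fderiv ℝ f) p b b)) := by
  have hl : ∀ s : ℝ, HasDerivAt (fun s : ℝ => p + s • b) b s := fun s => by
    simpa using ((hasDerivAt_id s).smul_const b).const_add p
  have h1 : HasFDerivAt (fderiv ℝ f) (fderiv ℝ (fderiv ℝ f) p) (p + (0:ℝ) • b) := by
    rw [zero_smul, add_zero]
    exact (hf' p).hasFDerivAt
  have h2 : HasDerivAt (fun s : ℝ => fderiv ℝ f (p + s • b)) (fderiv ℝ (fderiv ℝ f) p b) 0 :=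
    h1.comp_hasDerivAt (0:ℝ) (hl 0)
  have h3 : HasDerivAt (fun s : ℝ => fderiv ℝ f (p + s • b) b)
      (fderiv ℝ (fderiv ℝ f) p b b) 0 :=
    (ContinuousLinearMap.apply ℝ ℝ b).hasFDerivAt.comp_hasDerivAt (0:ℝ) h2
  have h := tendsto_symm_second_diff (g := fun s : ℝ => f (p + s • b))
    (Eventually.of_forall fun s => (hf _).hasFDerivAt.comp_hasDerivAt s (hl s)) h3
  simpa only [neg_smul, ← sub_eq_add_neg, zero_smul, add_zero] using h

/-- The centered third difference of `f` at `v` with half-steps `a`, `b`, `c`. -/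
def thirdDiff {E : Type*} [AddCommGroup E] (f : E → ℝ) (v a b c : E) : ℝ :=
  f (v + a + b + c) - f (v + a + b - c) - f (v + a - b + c) + f (v + a - b - c)
    - f (v - a + b + c) + f (v - a + b - c) + f (v - a - b + c) - f (v - a - b - c)

section ThirdDiff
variable {E : Type*} [AddCommGroup E] (f : E → ℝ) (v a b c w : E)

lemma thirdDiff_comm_left : thirdDiff f v a b c = thirdDiff f v b a c := by
  simp only [thirdDiff]; abel_nf

lemma thirdDiff_comm_outer : thirdDiff f v a b c = thirdDiff f v c b a := by
  simp only [thirdDiff]; abel_nf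

lemma thirdDiff_neg : thirdDiff (fun p => -f p) v a b c = -thirdDiff f v a b c := by
  simp only [thirdDiff]; ring

lemma thirdDiff_neg_left : thirdDiff f v (-a) b c = -thirdDiff f v a b c := by
  simp only [thirdDiff, ← sub_eq_add_neg, sub_neg_eq_add]; ring

lemma thirdDiff_zero_left : thirdDiff f v 0 b c = 0 := by
  simp only [thirdDiff, add_zero, sub_zero]; ring

lemma thirdDiff_second_diff_base :
    thirdDiff f (v + w) a b c + thirdDiff f (v - w) a b c - 2 * thirdDiff f v a b c =
      thirdDiff (fun p => f (p + w) + f (p - w) - 2 * f p) v a b c := by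
  simp only [thirdDiff]; abel_nf; simp only [zsmul_eq_mul]; push_cast; ring

lemma thirdDiff_second_diff_step :
    thirdDiff f v (a + w) b c + thirdDiff f v (a - w) b c - 2 * thirdDiff f v a b c =
      thirdDiff (fun p => f (p + w) + f (p - w) - 2 * f p) v a b c := by
  simp only [thirdDiff]; abel_nf; simp only [zsmul_eq_mul]; push_cast; ring
end ThirdDiff

lemma tendsto_thirdDiff {E ι : Type*} [AddCommGroup E] {l : Filter ι} {g : ι → E → ℝ} {G : E → ℝ}
    (h : ∀ p, Tendsto (fun s => g s p) l (𝓝 (G p))) (v a b c : E) :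
    Tendsto (fun s => thirdDiff (g s) v a b c) l (𝓝 (thirdDiff G v a b c)) := by
  simp only [thirdDiff]
  exact (((((((h _).sub (h _)).sub (h _)).add (h _)).sub (h _)).add (h _)).add (h _)).sub (h _)

lemma thirdDiff_div {E : Type*} [AddCommGroup E] (f : E → ℝ) (r : ℝ) (v a b c : E) :
    thirdDiff (fun p => f p / r) v a b c = thirdDiff f v a b c / r := by
  simp only [thirdDiff]; ring

lemma eventually_and_neg {P : ℝ → Prop} (h : ∀ᶠ s in 𝓝 (0:ℝ), P s) :
    ∀ᶠ s in 𝓝[≠] (0:ℝ), P s ∧ P (-s) := by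
  have ht : Tendsto (fun s : ℝ => -s) (𝓝 0) (𝓝 0) := by
    simpa using (continuous_neg (G := ℝ)).tendsto 0
  exact (h.and (ht.eventually h)).filter_mono nhdsWithin_le_nhds

lemma thirdDiff_hessian_le_of_max_base {E : Type*} [NormedAddCommGroup E] [InnerProductSpace ℝ E]
    {f : E → ℝ} (hf : Differentiable ℝ f) (hf' : Differentiable ℝ (fderiv ℝ f))
    {v v0 a b c e : E} {δ : ℝ}
    (h : ∀ᶠ s : ℝ in 𝓝 0, thirdDiff f (v + s • e) a b c - δ * ‖v + s • e - v0‖ ^ 2 ≤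
      thirdDiff f v a b c - δ * ‖v - v0‖ ^ 2) :
    thirdDiff (fun p => fderiv ℝ (fderiv ℝ f) p e e) v a b c ≤ 2 * δ * ‖e‖ ^ 2 := by
  have ht := tendsto_thirdDiff (fun p => tendsto_second_diff_fderiv hf hf' p e) v a b c
  refine le_of_tendsto ht ?_
  filter_upwards [eventually_and_neg h, self_mem_nhdsWithin] with s ⟨h1, h2⟩ hs
  have hs2 : 0 < s ^ 2 := by have : s ≠ 0 := hs; positivity
  rw [thirdDiff_div, div_le_iff₀ hs2, ← thirdDiff_second_diff_base]
  rw [neg_smul, ← sub_eq_add_neg] at h2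
  have hp := parallelogram_law_with_norm ℝ (v - v0) (s • e)
  have e1 : v + s • e - v0 = v - v0 + s • e := by abel
  have e2 : v - s • e - v0 = v - v0 - s • e := by abel
  rw [e1] at h1
  rw [e2] at h2
  have hn : ‖s • e‖ ^ 2 = s ^ 2 * ‖e‖ ^ 2 := by
    rw [norm_smul, mul_pow, Real.norm_eq_abs, sq_abs]
  rw [hn] at hp
  have hp' : δ * ‖v - v0 + s • e‖ ^ 2 + δ * ‖v - v0 - s • e‖ ^ 2 =
      2 * δ * ‖v - v0‖ ^ 2 + 2 * δ * (s ^ 2 * ‖e‖ ^ 2) := by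
    linear_combination δ * hp
  linarith

lemma tendsto_second_diff_rpow {y : ℝ} (hy : 0 < y) (β : ℝ) :
    Tendsto (fun s : ℝ => ((y + s) ^ β + (y - s) ^ β - 2 * y ^ β) / s ^ 2) (𝓝[≠] 0)
      (𝓝 (β * (β - 1) * y ^ (β - 2))) := by
  have hev : ∀ᶠ s in 𝓝 (0:ℝ), 0 < y + s := by
    have : Tendsto (fun s : ℝ => y + s) (𝓝 0) (𝓝 (y + 0)) := by
      exact (continuous_const.add continuous_id).tendsto 0
    exact this.eventually (lt_mem_nhds (by simpa using hy))
  have h := tendsto_symm_second_diff (g := fun s => (y + s) ^ β)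
    (g' := fun s => β * (y + s) ^ (β - 1)) (g'' := β * (β - 1) * y ^ (β - 2))
    (by
      filter_upwards [hev] with s hs
      have := ((hasDerivAt_id s).const_add y).rpow_const (p := β) (Or.inl hs.ne')
      simpa using this)
    (by
      have := (((hasDerivAt_id (0:ℝ)).const_add y).rpow_const (p := β - 1)
        (Or.inl (by simpa using hy.ne'))).const_mul β
      refine this.congr_deriv ?_
      simp only [id, add_zero, one_mul]
      rw [show β - 1 - 1 = β - 2 by ring]
      ring)
  simpa [sub_eq_add_neg] using h

lemma thirdDiff_hessian_le_of_max_step {E : Type*} [NormedAddCommGroup E] [NormedSpace ℝ E]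
    {f : E → ℝ} (hf : Differentiable ℝ f) (hf' : Differentiable ℝ (fderiv ℝ f))
    {v b c e : E} {y κ β m δ : ℝ} (hy : 0 < y)
    (h : ∀ᶠ s : ℝ in 𝓝 0,
      thirdDiff f v ((y + s) • e) b c - κ * (y + s) ^ β - m * (y + s) + δ * (y + s) ^ 2 ≤
      thirdDiff f v (y • e) b c - κ * y ^ β - m * y + δ * y ^ 2) :
    thirdDiff (fun p => fderiv ℝ (fderiv ℝ f) p e e) v (y • e) b c ≤
      κ * (β * (β - 1) * y ^ (β - 2)) - 2 * δ := by
  have ht := tendsto_thirdDiff (fun p => tendsto_second_diff_fderiv hf hf' p e) v (y • e) b c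
  have ht2 := ((tendsto_second_diff_rpow hy β).const_mul κ).sub_const (2 * δ)
  refine le_of_tendsto_of_tendsto ht ht2 ?_
  filter_upwards [eventually_and_neg h, self_mem_nhdsWithin] with s ⟨h1, h2⟩ hs
  have hs2 : 0 < s ^ 2 := by have : s ≠ 0 := hs; positivity
  rw [thirdDiff_div, ← thirdDiff_second_diff_step, ← add_smul, ← sub_smul]
  rw [← sub_eq_add_neg] at h2
  rw [div_le_iff₀ hs2, sub_mul, mul_div_assoc', div_mul_cancel₀ _ hs2.ne']
  nlinarith

lemma abs_thirdDiff_le_holder {E : Type*} [NormedAddCommGroup E] [NormedSpace ℝ E] {F : E → ℝ}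
    {K α : ℝ} (hα0 : 0 < α) (hα1 : α < 1) (hK : 0 ≤ K)
    (hF : ∀ p q, |F p - F q| ≤ K * ‖p - q‖ ^ α) {y : ℝ} (hy : 0 < y) {e : E} (he : ‖e‖ = 1)
    (v b c : E) : |thirdDiff F v (y • e) b c| ≤ 8 * K * y ^ α := by
  have h2 : (2 * y) ^ α ≤ 2 * y ^ α := by
    rw [Real.mul_rpow (by norm_num) hy.le]
    gcongr
    calc (2:ℝ) ^ α ≤ 2 ^ (1:ℝ) := Real.rpow_le_rpow_of_exponent_le (by norm_num) hα1.le
      _ = 2 := by simp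
  have key : ∀ q : E, |F (v + y • e + q) - F (v - y • e + q)| ≤ 2 * K * y ^ α := by
    intro q
    refine (hF _ _).trans ?_
    have : v + y • e + q - (v - y • e + q) = (2 * y) • e := by
      rw [mul_smul, two_smul]; abel
    rw [this, norm_smul, he, mul_one, Real.norm_of_nonneg (by positivity)]
    nlinarith
  have e1 : thirdDiff F v (y • e) b c =
      (F (v + y • e + (b + c)) - F (v - y • e + (b + c)))
      - (F (v + y • e + (b - c)) - F (v - y • e + (b - c)))
      - (F (v + y • e + (-b + c)) - F (v - y • e + (-b + c)))
      + (F (v + y • e + (-b - c)) - F (v - y • e + (-b - c))) := by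
    simp only [thirdDiff, ← add_assoc, ← add_sub_assoc, ← sub_eq_add_neg]; ring
  have k1 := abs_le.1 (key (b + c))
  have k2 := abs_le.1 (key (b - c))
  have k3 := abs_le.1 (key (-b + c))
  have k4 := abs_le.1 (key (-b - c))
  rw [e1, abs_le]
  constructor <;> linarith [k1.1, k1.2, k2.1, k2.2, k3.1, k3.2, k4.1, k4.2]

lemma abs_thirdDiff_le_of_bound {E : Type*} [AddCommGroup E] {f : E → ℝ} {M : ℝ}
    (hM : ∀ p, |f p| ≤ M) (v a b c : E) : |thirdDiff f v a b c| ≤ 8 * M := by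
  have h := fun p => abs_le.1 (hM p)
  simp only [thirdDiff]
  rw [abs_le]
  constructor <;>
  linarith [h (v + a + b + c), h (v + a + b - c), h (v + a - b + c), h (v + a - b - c),
    h (v - a + b + c), h (v - a + b - c), h (v - a - b + c), h (v - a - b - c)]

lemma thirdDiff_laplacian {d : ℕ} (H : Ed d → Ed d →L[ℝ] Ed d →L[ℝ] ℝ) (v a b c : Ed d) :
    thirdDiff (fun p => ∑ l, H p (EuclideanSpace.single l 1) (EuclideanSpace.single l 1)) v a b c =
      ∑ l, thirdDiff (fun p => H p (EuclideanSpace.single l 1) (EuclideanSpace.single l 1))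
        v a b c := by
  simp only [thirdDiff, Finset.sum_add_distrib, Finset.sum_sub_distrib]

lemma thirdDiff_hessian_contra {d : ℕ} {H : Ed d → Ed d →L[ℝ] Ed d →L[ℝ] ℝ} {K α β κ δ y : ℝ}
    (hα0 : 0 < α) (hα1 : α < 1) (hK : 0 ≤ K) (hδ : 0 < δ) (hy : 0 < y)
    (hF : ∀ p q, |(∑ l, H p (EuclideanSpace.single l 1) (EuclideanSpace.single l 1)) -
      ∑ l, H q (EuclideanSpace.single l 1) (EuclideanSpace.single l 1)| ≤ K * ‖p - q‖ ^ α)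
    (v b c : Ed d) (i : Fin d)
    (hbase : ∀ l, thirdDiff (fun p => H p (EuclideanSpace.single l 1) (EuclideanSpace.single l 1))
      v (y • EuclideanSpace.single i 1) b c ≤ 2 * δ)
    (hstep : thirdDiff (fun p => H p (EuclideanSpace.single i 1) (EuclideanSpace.single i 1))
      v (y • EuclideanSpace.single i 1) b c ≤ κ * (β * (β - 1) * y ^ (β - 2)) - 2 * (δ * d))
    (hκ : 8 * K * y ^ α ≤ κ * (β * (1 - β) * y ^ (β - 2))) : False := by
  have h1 := abs_thirdDiff_le_holder hα0 hα1 hK hF hy (e := EuclideanSpace.single i 1)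
    (by simp) v b c
  rw [thirdDiff_laplacian, ← Finset.add_sum_erase _ _ (Finset.mem_univ i)] at h1
  have h2 := Finset.sum_le_card_nsmul (Finset.univ.erase i) _ (2 * δ) (fun l _ => hbase l)
  have hd : 1 ≤ d := Nat.lt_of_le_of_lt (Nat.zero_le _) i.2
  rw [Finset.card_erase_of_mem (Finset.mem_univ i), Finset.card_univ, Fintype.card_fin,
    nsmul_eq_mul, Nat.cast_sub hd] at h2
  have h3 := (abs_le.1 h1).1
  have h4 : κ * (β * (β - 1) * y ^ (β - 2)) = -(κ * (β * (1 - β) * y ^ (β - 2))) := by ring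
  push_cast at h2
  nlinarith

lemma rpow_le_mul_rpow_of_le {α β y b c : ℝ} (hαβ : 3 * β - 2 = α) (hβ : 0 < β) (hy : 0 < y)
    (hb : y ≤ b) (hc : y ≤ c) : y ^ α ≤ (b * c) ^ β * y ^ (β - 2) := by
  have h1 : y ^ α = (y * y) ^ β * y ^ (β - 2) := by
    rw [Real.mul_rpow hy.le hy.le, ← Real.rpow_add hy, ← Real.rpow_add hy]
    congr 1; linarith
  rw [h1]
  have hb0 := hy.le.trans hb
  have hc0 := hy.le.trans hc
  gcongr

/-- A bounded function of `(v, y₁, y₂, y₃)` that vanishes on the coordinate faces and exceeds the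
barrier `C (y₁ y₂ y₃) ^ β` somewhere, touches a perturbed barrier at an interior point. -/
lemma exists_interior_max_sub_barrier {E : Type*} [NormedAddCommGroup E] [ProperSpace E]
    {Φ : E → ℝ → ℝ → ℝ → ℝ} {L C β D : ℝ} (hL : 0 ≤ L) (hC : 0 ≤ C) (hβ : 0 < β) (hD : 0 ≤ D)
    (hΦ : Continuous fun p : E × ℝ × ℝ × ℝ => Φ p.1 p.2.1 p.2.2.1 p.2.2.2)
    (hΦL : ∀ v x y z, Φ v x y z ≤ L) (h1 : ∀ v y z, Φ v 0 y z = 0) (h2 : ∀ v x z, Φ v x 0 z = 0)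
    (h3 : ∀ v x y, Φ v x y 0 = 0) {v0 : E} {a b c : ℝ} (ha : 0 < a) (hb : 0 < b) (hc : 0 < c)
    (h : C * (a * b * c) ^ β < Φ v0 a b c) :
    ∃ (v : E) (y₁ y₂ y₃ δ m : ℝ), 0 < δ ∧ 0 < y₁ ∧ 0 < y₂ ∧ 0 < y₃ ∧
      (∀ᶠ w in 𝓝 v, Φ w y₁ y₂ y₃ - δ * ‖w - v0‖ ^ 2 ≤ Φ v y₁ y₂ y₃ - δ * ‖v - v0‖ ^ 2) ∧
      (∀ᶠ y in 𝓝 y₁, Φ v y y₂ y₃ - C * (y * y₂ * y₃) ^ β - m * y + δ * D * y ^ 2 ≤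
        Φ v y₁ y₂ y₃ - C * (y₁ * y₂ * y₃) ^ β - m * y₁ + δ * D * y₁ ^ 2) ∧
      (∀ᶠ y in 𝓝 y₂, Φ v y₁ y y₃ - C * (y₁ * y * y₃) ^ β - m * y + δ * D * y ^ 2 ≤
        Φ v y₁ y₂ y₃ - C * (y₁ * y₂ * y₃) ^ β - m * y₂ + δ * D * y₂ ^ 2) ∧
      (∀ᶠ y in 𝓝 y₃, Φ v y₁ y₂ y - C * (y₁ * y₂ * y) ^ β - m * y + δ * D * y ^ 2 ≤
        Φ v y₁ y₂ y₃ - C * (y₁ * y₂ * y₃) ^ β - m * y₃ + δ * D * y₃ ^ 2) := by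
  obtain ⟨g, hg0, hg⟩ : ∃ g, 0 < g ∧ Φ v0 a b c = C * (a * b * c) ^ β + g :=
    ⟨_, sub_pos.2 h, by ring⟩
  obtain ⟨R, hRa, hRb, hRc, hR⟩ : ∃ R, a < R ∧ b < R ∧ c < R ∧ L * (a + b + c) ≤ g / 4 * R := by
    have : 0 ≤ 4 * L * (a + b + c) / g := by positivity
    refine ⟨a + b + c + 4 * L * (a + b + c) / g, by linarith, by linarith, by linarith, ?_⟩
    have h0 : g / 4 * (4 * L * (a + b + c) / g) = L * (a + b + c) := by field_simp
    nlinarith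
  have hR0 : 0 < R := ha.trans hRa
  obtain ⟨m, hm0, hmR⟩ : ∃ m, 0 ≤ m ∧ m * R = L := ⟨L / R, by positivity, by field_simp⟩
  have hm1 : m * (a + b + c) ≤ g / 4 := by
    have : m * (a + b + c) * R ≤ g / 4 * R := by linarith [congrArg (· * (a + b + c)) hmR]
    exact le_of_mul_le_mul_right this hR0
  obtain ⟨δ, hδ0, hδ⟩ : ∃ δ, 0 < δ ∧ δ * D * (3 * R ^ 2) ≤ g / 4 := by
    refine ⟨g / (4 * (D * (3 * R ^ 2) + 1)), by positivity, ?_⟩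
    rw [div_mul_eq_mul_div, div_mul_eq_mul_div, div_le_div_iff₀ (by positivity) (by positivity)]
    nlinarith
  obtain ⟨r, hr0, hr⟩ : ∃ r, 0 < r ∧ L < δ * r ^ 2 := by
    have h0 : 0 ≤ L / δ := by positivity
    refine ⟨L / δ + 1, by positivity, ?_⟩
    have h1 : L / δ * δ = L := by field_simp
    nlinarith [mul_nonneg h0 h0]
  obtain ⟨G, hG⟩ : ∃ G : E × ℝ × ℝ × ℝ → ℝ, ∀ v x y z, G (v, x, y, z) =
      Φ v x y z - C * (x * y * z) ^ β - m * (x + y + z) - δ * ‖v - v0‖ ^ 2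
      - δ * D * (3 * R ^ 2 - x ^ 2 - y ^ 2 - z ^ 2) :=
    ⟨fun p => Φ p.1 p.2.1 p.2.2.1 p.2.2.2 - C * (p.2.1 * p.2.2.1 * p.2.2.2) ^ β
      - m * (p.2.1 + p.2.2.1 + p.2.2.2) - δ * ‖p.1 - v0‖ ^ 2
      - δ * D * (3 * R ^ 2 - p.2.1 ^ 2 - p.2.2.1 ^ 2 - p.2.2.2 ^ 2), fun _ _ _ _ => rfl⟩
  have hGc : Continuous G := by
    have e : G = fun p => Φ p.1 p.2.1 p.2.2.1 p.2.2.2 - C * (p.2.1 * p.2.2.1 * p.2.2.2) ^ β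
      - m * (p.2.1 + p.2.2.1 + p.2.2.2) - δ * ‖p.1 - v0‖ ^ 2
      - δ * D * (3 * R ^ 2 - p.2.1 ^ 2 - p.2.2.1 ^ 2 - p.2.2.2 ^ 2) := by
      funext ⟨v, x, y, z⟩; exact hG v x y z
    rw [e]
    have h1 : Continuous fun p : E × ℝ × ℝ × ℝ => (p.2.1 * p.2.2.1 * p.2.2.2) ^ β :=
      Continuous.rpow_const (by fun_prop) fun _ => Or.inr hβ.le
    fun_prop
  obtain ⟨⟨v, y₁, y₂, y₃⟩, hp, hmax⟩ :=
    ((isCompact_closedBall v0 r).prod (isCompact_Icc.prod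
      (isCompact_Icc.prod isCompact_Icc))).exists_isMaxOn
      (s := Metric.closedBall v0 r ×ˢ Icc 0 R ×ˢ Icc 0 R ×ˢ Icc 0 R)
      ⟨(v0, a, b, c), ⟨Metric.mem_closedBall_self hr0.le, ⟨ha.le, hRa.le⟩, ⟨hb.le, hRb.le⟩,
        ⟨hc.le, hRc.le⟩⟩⟩ hGc.continuousOn
  have hmax' : ∀ w x y z, w ∈ Metric.closedBall v0 r → x ∈ Icc 0 R → y ∈ Icc 0 R → z ∈ Icc 0 R →
      G (w, x, y, z) ≤ G (v, y₁, y₂, y₃) :=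
    fun w x y z hw hx hy hz => isMaxOn_iff.1 hmax (w, x, y, z) ⟨hw, hx, hy, hz⟩
  simp only [hG] at hmax'
  clear hmax hGc
  obtain ⟨hv, hy₁, hy₂, hy₃⟩ : v ∈ Metric.closedBall v0 r ∧ y₁ ∈ Icc 0 R ∧ y₂ ∈ Icc 0 R ∧
    y₃ ∈ Icc 0 R := hp
  have hpos := hmax' v0 a b c (Metric.mem_closedBall_self hr0.le) ⟨ha.le, hRa.le⟩
    ⟨hb.le, hRb.le⟩ ⟨hc.le, hRc.le⟩
  rw [hg, sub_self, norm_zero] at hpos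
  have ha2 : 0 ≤ δ * D * (a ^ 2 + b ^ 2 + c ^ 2) := by positivity
  have n1 : 0 ≤ C * (y₁ * y₂ * y₃) ^ β :=
    mul_nonneg hC (Real.rpow_nonneg (mul_nonneg (mul_nonneg hy₁.1 hy₂.1) hy₃.1) _)
  have n2 : 0 ≤ m * y₁ := mul_nonneg hm0 hy₁.1
  have n3 : 0 ≤ m * y₂ := mul_nonneg hm0 hy₂.1
  have n4 : 0 ≤ m * y₃ := mul_nonneg hm0 hy₃.1
  have n5 : 0 ≤ δ * ‖v - v0‖ ^ 2 := by positivity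
  have n6 : 0 ≤ δ * D * (3 * R ^ 2 - y₁ ^ 2 - y₂ ^ 2 - y₃ ^ 2) := by
    have s1 := pow_le_pow_left₀ hy₁.1 hy₁.2 2
    have s2 := pow_le_pow_left₀ hy₂.1 hy₂.2 2
    have s3 := pow_le_pow_left₀ hy₃.1 hy₃.2 2
    exact mul_nonneg (by positivity) (by linarith)
  have key : C * (y₁ * y₂ * y₃) ^ β + m * y₁ + m * y₂ + m * y₃ + δ * ‖v - v0‖ ^ 2 <
      Φ v y₁ y₂ y₃ := by linarith
  have hT := hΦL v y₁ y₂ y₃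
  have p1 : 0 < y₁ := lt_of_le_of_ne hy₁.1 fun h0 => by
    have := h1 v y₂ y₃; rw [h0] at this; linarith
  have p2 : 0 < y₂ := lt_of_le_of_ne hy₂.1 fun h0 => by
    have := h2 v y₁ y₃; rw [h0] at this; linarith
  have p3 : 0 < y₃ := lt_of_le_of_ne hy₃.1 fun h0 => by
    have := h3 v y₁ y₂; rw [h0] at this; linarith
  have q1 : y₁ < R := lt_of_le_of_ne hy₁.2 fun h0 => by rw [← h0] at hmR; linarith
  have q2 : y₂ < R := lt_of_le_of_ne hy₂.2 fun h0 => by rw [← h0] at hmR; linarith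
  have q3 : y₃ < R := lt_of_le_of_ne hy₃.2 fun h0 => by rw [← h0] at hmR; linarith
  have qv : v ∈ Metric.ball v0 r := by
    rw [mem_ball_iff_norm]
    by_contra! hle
    have := pow_le_pow_left₀ hr0.le hle 2
    nlinarith
  refine ⟨v, y₁, y₂, y₃, δ, m, hδ0, p1, p2, p3, ?_, ?_, ?_, ?_⟩
  · filter_upwards [Metric.isOpen_ball.mem_nhds qv] with w hw
    linarith [hmax' w y₁ y₂ y₃ (Metric.ball_subset_closedBall hw) hy₁ hy₂ hy₃]
  · filter_upwards [Icc_mem_nhds p1 q1] with y hy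
    linarith [hmax' v y y₂ y₃ hv hy hy₂ hy₃]
  · filter_upwards [Icc_mem_nhds p2 q2] with y hy
    linarith [hmax' v y₁ y y₃ hv hy₁ hy hy₃]
  · filter_upwards [Icc_mem_nhds p3 q3] with y hy
    linarith [hmax' v y₁ y₂ y hv hy₁ hy₂ hy]

lemma thirdDiff_min_step_contra {d : ℕ} {f : Ed d → ℝ} (hf : Differentiable ℝ f)
    (hf' : Differentiable ℝ (fderiv ℝ f)) {C K α β m δ y x z : ℝ}
    (hα0 : 0 < α) (hα1 : α < 1) (hK : 0 ≤ K) (hαβ : 3 * β - 2 = α) (hδ : 0 < δ)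
    (hC : C * (β * (1 - β)) = 8 * K)
    (hF : ∀ p q,
      |(∑ l, fderiv ℝ (fderiv ℝ f) p (EuclideanSpace.single l 1) (EuclideanSpace.single l 1)) -
      ∑ l, fderiv ℝ (fderiv ℝ f) q (EuclideanSpace.single l 1) (EuclideanSpace.single l 1)|
        ≤ K * ‖p - q‖ ^ α)
    {v v0 b c : Ed d} {i : Fin d} (hy : 0 < y) (hx : y ≤ x) (hz : y ≤ z)
    (hbase : ∀ᶠ w in 𝓝 v, thirdDiff f w (y • EuclideanSpace.single i 1) b c - δ * ‖w - v0‖ ^ 2 ≤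
      thirdDiff f v (y • EuclideanSpace.single i 1) b c - δ * ‖v - v0‖ ^ 2)
    (hstep : ∀ᶠ s in 𝓝 y, thirdDiff f v (s • EuclideanSpace.single i 1) b c - C * (s * x * z) ^ β
        - m * s + δ * d * s ^ 2 ≤
      thirdDiff f v (y • EuclideanSpace.single i 1) b c - C * (y * x * z) ^ β
        - m * y + δ * d * y ^ 2) : False := by
  have hβ0 : 0 < β := by linarith
  have hx0 := hy.le.trans hx
  have hz0 := hy.le.trans hz
  have hxz : 0 ≤ x * z := mul_nonneg hx0 hz0
  refine thirdDiff_hessian_contra (H := fderiv ℝ (fderiv ℝ f)) (κ := C * (x * z) ^ β) (β := β)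
    hα0 hα1 hK hδ hy hF v b c i (fun l => ?_) ?_ ?_
  · have h := thirdDiff_hessian_le_of_max_base hf hf' (v := v) (v0 := v0) (δ := δ)
      (a := y • EuclideanSpace.single i 1) (b := b) (c := c) (e := EuclideanSpace.single l 1) ?_
    · rwa [PiLp.norm_single, norm_one, one_pow, mul_one] at h
    have hc : Tendsto (fun s : ℝ => v + s • (EuclideanSpace.single l 1 : Ed d)) (𝓝 0) (𝓝 v) := by
      have : Continuous fun s : ℝ => v + s • (EuclideanSpace.single l 1 : Ed d) := by fun_prop
      simpa using this.tendsto 0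
    exact hc.eventually hbase
  · refine thirdDiff_hessian_le_of_max_step hf hf' (m := m) hy ?_
    have hc : Tendsto (fun s : ℝ => y + s) (𝓝 0) (𝓝 y) := by
      have : Continuous fun s : ℝ => y + s := by fun_prop
      simpa using this.tendsto 0
    have hpos : ∀ᶠ s in 𝓝 y, 0 < s := lt_mem_nhds hy
    filter_upwards [hc.eventually hstep, hc.eventually hpos] with s hs hs0
    rw [mul_assoc (y + s), mul_assoc y, Real.mul_rpow hs0.le hxz, Real.mul_rpow hy.le hxz] at hs
    linarith
  · have := rpow_le_mul_rpow_of_le hαβ hβ0 hy hx hz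
    calc 8 * K * y ^ α ≤ 8 * K * ((x * z) ^ β * y ^ (β - 2)) := by gcongr
      _ = _ := by rw [← hC]; ring

theorem thirdDiff_le_of_laplacian_holder {d : ℕ} {f : Ed d → ℝ} (hf : Differentiable ℝ f)
    (hf' : Differentiable ℝ (fderiv ℝ f)) {M K α β : ℝ} (hM : ∀ p, |f p| ≤ M)
    (hα0 : 0 < α) (hα1 : α < 1) (hK : 0 ≤ K) (hαβ : 3 * β - 2 = α)
    (hF : ∀ p q,
      |(∑ l, fderiv ℝ (fderiv ℝ f) p (EuclideanSpace.single l 1) (EuclideanSpace.single l 1)) -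
      ∑ l, fderiv ℝ (fderiv ℝ f) q (EuclideanSpace.single l 1) (EuclideanSpace.single l 1)|
        ≤ K * ‖p - q‖ ^ α)
    (v0 : Ed d) (i j k : Fin d) {a b c : ℝ} (ha : 0 < a) (hb : 0 < b) (hc : 0 < c) :
    thirdDiff f v0 (a • EuclideanSpace.single i 1) (b • EuclideanSpace.single j 1)
      (c • EuclideanSpace.single k 1) ≤ 8 / (β * (1 - β)) * K * (a * b * c) ^ β := by
  by_contra! hcon
  have hβ0 : 0 < β := by linarith
  have hβ1 : 0 < 1 - β := by linarith
  have hM0 : 0 ≤ M := (abs_nonneg _).trans (hM 0)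
  have hC0 : 0 ≤ 8 / (β * (1 - β)) * K := by positivity
  have hCK : 8 / (β * (1 - β)) * K * (β * (1 - β)) = 8 * K := by field_simp
  generalize 8 / (β * (1 - β)) * K = C at hcon hC0 hCK
  obtain ⟨v, y₁, y₂, y₃, δ, m, hδ, p1, p2, p3, hbase, hs1, hs2, hs3⟩ :=
    exists_interior_max_sub_barrier (Φ := fun v x y z => thirdDiff f v
      (x • EuclideanSpace.single i 1) (y • EuclideanSpace.single j 1)
      (z • EuclideanSpace.single k 1)) (L := 8 * M) (D := d) (by positivity) hC0 hβ0
      (Nat.cast_nonneg d)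
      (by have hfc := hf.continuous
          simp only [thirdDiff]
          fun_prop)
      (fun v x y z => (abs_le.1 (abs_thirdDiff_le_of_bound hM v _ _ _)).2)
      (fun v y z => by simp only [zero_smul, thirdDiff_zero_left])
      (fun v y z => by rw [thirdDiff_comm_left]; simp only [zero_smul, thirdDiff_zero_left])
      (fun v y z => by rw [thirdDiff_comm_outer]; simp only [zero_smul, thirdDiff_zero_left])
      ha hb hc hcon
  have c1 : y₁ ≤ y₂ → y₁ ≤ y₃ → False := fun h1 h2 =>
    thirdDiff_min_step_contra hf hf' hα0 hα1 hK hαβ hδ hCK hF p1 h1 h2 hbase hs1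
  have c2 : y₂ ≤ y₁ → y₂ ≤ y₃ → False := fun h1 h2 => by
    simp only [thirdDiff_comm_left f _ (_ • EuclideanSpace.single i (1 : ℝ))] at hbase hs2
    refine thirdDiff_min_step_contra hf hf' hα0 hα1 hK hαβ hδ hCK hF p2 h1 h2 hbase (m := m) ?_
    simpa only [mul_comm y₁] using hs2
  have c3 : y₃ ≤ y₁ → y₃ ≤ y₂ → False := fun h1 h2 => by
    simp only [thirdDiff_comm_outer f _ (_ • EuclideanSpace.single i (1 : ℝ))] at hbase hs3
    refine thirdDiff_min_step_contra hf hf' hα0 hα1 hK hαβ hδ hCK hF p3 h1 h2 hbase (m := m) ?_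
    filter_upwards [hs3] with s hs
    rw [mul_comm (y₁ * y₂), mul_comm (y₁ * y₂), ← mul_assoc, ← mul_assoc] at hs
    exact hs
  rcases le_total y₁ y₂ with h12 | h12 <;> rcases le_total y₁ y₃ with h13 | h13 <;>
    rcases le_total y₂ y₃ with h23 | h23 <;>
    first
      | exact c1 h12 h13
      | exact c2 h12 h23
      | exact c3 h13 h23
      | exact c1 h12 (h12.trans h23)
      | exact c2 h12 (h12.trans h13)

theorem abs_thirdDiff_le_of_laplacian_holder {d : ℕ} {f : Ed d → ℝ} (hf : Differentiable ℝ f)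
    (hf' : Differentiable ℝ (fderiv ℝ f)) {M K α β : ℝ} (hM : ∀ p, |f p| ≤ M)
    (hα0 : 0 < α) (hα1 : α < 1) (hK : 0 ≤ K) (hαβ : 3 * β - 2 = α)
    (hF : ∀ p q,
      |(∑ l, fderiv ℝ (fderiv ℝ f) p (EuclideanSpace.single l 1) (EuclideanSpace.single l 1)) -
      ∑ l, fderiv ℝ (fderiv ℝ f) q (EuclideanSpace.single l 1) (EuclideanSpace.single l 1)|
        ≤ K * ‖p - q‖ ^ α)
    (v : Ed d) (i j k : Fin d) (a b c : ℝ) :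
    |thirdDiff f v (a • EuclideanSpace.single i 1) (b • EuclideanSpace.single j 1)
      (c • EuclideanSpace.single k 1)| ≤ 8 / (β * (1 - β)) * K * (|a| * |b| * |c|) ^ β := by
  have hβ0 : 0 < β := by linarith
  have hβ1 : 0 < 1 - β := by linarith
  have pos : ∀ {a b c : ℝ}, 0 < a → 0 < b → 0 < c → |thirdDiff f v
      (a • EuclideanSpace.single i 1) (b • EuclideanSpace.single j 1)
      (c • EuclideanSpace.single k 1)| ≤ 8 / (β * (1 - β)) * K * (a * b * c) ^ β := by
    intro a b c ha hb hc
    refine abs_le'.2 ⟨thirdDiff_le_of_laplacian_holder hf hf' hM hα0 hα1 hK hαβ hF v i j k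
      ha hb hc, ?_⟩
    rw [← thirdDiff_neg]
    have e1 : fderiv ℝ (fun p => -f p) = fun p => -fderiv ℝ f p := by
      funext p; exact fderiv_fun_neg
    have e2 : fderiv ℝ (fun p => -fderiv ℝ f p) = fun p => -fderiv ℝ (fderiv ℝ f) p := by
      funext p; exact fderiv_fun_neg
    refine thirdDiff_le_of_laplacian_holder hf.fun_neg (by rw [e1]; exact hf'.fun_neg) (M := M)
      (fun p => by rw [abs_neg]; exact hM p) hα0 hα1 hK hαβ (fun p q => ?_) v i j k ha hb hc
    rw [e1, e2]
    simp only [neg_apply, Finset.sum_neg_distrib]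
    rw [neg_sub_neg, abs_sub_comm]
    exact hF p q
  have nl : ∀ (s : ℝ) (i : Fin d) (b c : Ed d), |thirdDiff f v (|s| • EuclideanSpace.single i 1) b c|
      = |thirdDiff f v (s • EuclideanSpace.single i 1) b c| := by
    intro s i b c
    rcases abs_choice s with h | h
    · rw [h]
    · rw [h, neg_smul, thirdDiff_neg_left, abs_neg]
  rcases eq_or_ne a 0 with rfl | ha
  · rw [zero_smul, thirdDiff_zero_left, abs_zero]; positivity
  rcases eq_or_ne b 0 with rfl | hb
  · rw [zero_smul, thirdDiff_comm_left, thirdDiff_zero_left, abs_zero]; positivity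
  rcases eq_or_ne c 0 with rfl | hc
  · rw [zero_smul, thirdDiff_comm_outer, thirdDiff_zero_left, abs_zero]; positivity
  rw [← nl a, thirdDiff_comm_left, ← nl b, thirdDiff_comm_outer, ← nl c, thirdDiff_comm_outer,
    thirdDiff_comm_left]
  exact pos (abs_pos.2 ha) (abs_pos.2 hb) (abs_pos.2 hc)

lemma HasDerivAt.nonneg_of_eventually_le_left {g : ℝ → ℝ} {g' x : ℝ} (hg : HasDerivAt g g' x)
    (h : ∀ᶠ y in 𝓝[<] x, g y ≤ g x) : 0 ≤ g' := by
  have h1 : Tendsto (slope g x) (𝓝[<] x) (𝓝 g') := (hasDerivAt_iff_tendsto_slope.1 hg).mono_left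
    (nhdsWithin_mono x fun y (hy : y < x) => ne_of_lt hy)
  refine ge_of_tendsto h1 ?_
  filter_upwards [h, self_mem_nhdsWithin] with y hy hyx
  rw [slope_def_field]
  exact div_nonneg_of_nonpos (sub_nonpos.2 hy) (sub_nonpos.2 (le_of_lt hyx))

/-- If the sum of the two partial derivatives of a continuous function is bounded by `M` near the
diagonal, then its restriction to the diagonal grows at rate at most `M`. -/
theorem diagonal_sub_le_of_sum_partial_le {Φ p q : ℝ → ℝ → ℝ} {t₁ t₂ δ M : ℝ} (ht : t₁ ≤ t₂)
    (hδ : 0 < δ)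
    (hc : ContinuousOn (fun z : ℝ × ℝ => Φ z.1 z.2) (Icc (t₁ - δ) (t₂ + δ) ×ˢ Icc (t₁ - δ) (t₂ + δ)))
    (hp : ∀ τ ∈ Icc (t₁ - δ) (t₂ + δ), ∀ r ∈ Icc (t₁ - δ) (t₂ + δ),
      HasDerivAt (fun s => Φ s r) (p τ r) τ)
    (hq : ∀ τ ∈ Icc (t₁ - δ) (t₂ + δ), ∀ r ∈ Icc (t₁ - δ) (t₂ + δ),
      HasDerivAt (fun s => Φ τ s) (q τ r) r)
    (hpq : ∀ τ ∈ Icc (t₁ - δ) (t₂ + δ), ∀ r ∈ Icc (t₁ - δ) (t₂ + δ), p τ r + q τ r ≤ M) :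
    Φ t₂ t₂ - Φ t₁ t₁ ≤ M * (t₂ - t₁) := by
  by_contra! hcon
  obtain ⟨ε, hε, hgap⟩ : ∃ ε, 0 < ε ∧ (M + ε) * (t₂ - t₁) < Φ t₂ t₂ - Φ t₁ t₁ := by
    refine ⟨(Φ t₂ t₂ - Φ t₁ t₁ - M * (t₂ - t₁)) / (2 * (t₂ - t₁ + 1)),
      div_pos (by linarith) (by linarith), ?_⟩
    set g := Φ t₂ t₂ - Φ t₁ t₁ - M * (t₂ - t₁) with hg
    have h1 : g / (2 * (t₂ - t₁ + 1)) * (t₂ - t₁) ≤ g / 2 := by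
      rw [div_mul_eq_mul_div, div_le_div_iff₀ (by linarith) (by norm_num)]
      nlinarith
    linarith
  have hJ : Icc (t₁ - δ) (t₂ + δ) ∈ 𝓝 t₁ := Icc_mem_nhds (by linarith) (by linarith)
  have hc1 : ContinuousAt (fun z : ℝ × ℝ => Φ z.1 z.2 - (M + ε) * z.1) (t₁, t₁) :=
    (hc.continuousAt (prod_mem_nhds hJ hJ)).sub (by fun_prop)
  have hev := hc1.eventually (gt_mem_nhds
    (show Φ t₁ t₁ - (M + ε) * t₁ < Φ t₂ t₂ - (M + ε) * t₂ by linarith))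
  obtain ⟨η, hη, hbot⟩ := Metric.eventually_nhds_iff_ball.1 hev
  obtain ⟨κ, hκ, hκη, hκδ⟩ : ∃ κ, 0 < κ ∧ κ < η ∧ κ < δ :=
    ⟨min η δ / 2, by positivity, by linarith [min_le_left η δ, lt_min hη hδ],
      by linarith [min_le_right η δ, lt_min hη hδ]⟩
  set S : Set (ℝ × ℝ) := {z | |z.2 - z.1| ≤ κ ∧ 2 * t₁ ≤ z.1 + z.2 ∧ z.1 + z.2 ≤ 2 * t₂} with hS
  have hSJ : S ⊆ Icc (t₁ - δ) (t₂ + δ) ×ˢ Icc (t₁ - δ) (t₂ + δ) := by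
    rintro ⟨x, y⟩ ⟨h1, h2, h3⟩
    have := abs_le.1 h1
    simp only at this h2 h3
    refine ⟨⟨?_, ?_⟩, ⟨?_, ?_⟩⟩ <;> simp only <;> linarith
  have hScl : IsClosed S := by
    have i1 : IsClosed {z : ℝ × ℝ | |z.2 - z.1| ≤ κ} := isClosed_le (by fun_prop) (by fun_prop)
    have i2 : IsClosed {z : ℝ × ℝ | 2 * t₁ ≤ z.1 + z.2} := isClosed_le (by fun_prop) (by fun_prop)
    have i3 : IsClosed {z : ℝ × ℝ | z.1 + z.2 ≤ 2 * t₂} := isClosed_le (by fun_prop) (by fun_prop)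
    exact i1.inter (i2.inter i3)
  have hSc : IsCompact S := (isCompact_Icc.prod isCompact_Icc).of_isClosed_subset hScl hSJ
  have hcS := hc.mono hSJ
  have hcΨ : ContinuousOn (fun z : ℝ × ℝ => Φ z.1 z.2 - (M + ε) * z.1) S :=
    hcS.sub (by fun_prop)
  have ht2S : (t₂, t₂) ∈ S := ⟨by simpa using hκ.le, by simp only; linarith, by simp only; linarith⟩
  obtain ⟨z0, hz0, hB⟩ := hSc.exists_isMaxOn ⟨_, ht2S⟩ hcΨ
  obtain ⟨A, hA⟩ : ∃ A, Φ z0.1 z0.2 - (M + ε) * z0.1 - (Φ t₂ t₂ - (M + ε) * t₂) < A * κ ^ 2 := by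
    set X := Φ z0.1 z0.2 - (M + ε) * z0.1 - (Φ t₂ t₂ - (M + ε) * t₂)
    refine ⟨(X + 1) / κ ^ 2, ?_⟩
    rw [div_mul_cancel₀ _ (by positivity)]
    linarith
  obtain ⟨⟨τ, r⟩, hz, hmax⟩ := hSc.exists_isMaxOn ⟨_, ht2S⟩
    (f := fun z : ℝ × ℝ => Φ z.1 z.2 - (M + ε) * z.1 - A * (z.2 - z.1) ^ 2)
    (hcΨ.sub (by fun_prop))
  have hmax' := isMaxOn_iff.1 hmax
  have htop := hmax' _ ht2S
  have hBz := isMaxOn_iff.1 hB _ hz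
  simp only [sub_self] at htop hBz
  have hlat : |r - τ| < κ := by
    refine lt_of_le_of_ne hz.1 fun h => ?_
    have : (r - τ) ^ 2 = κ ^ 2 := by rw [← sq_abs, ← h]
    rw [this] at htop
    linarith
  have hsum : 2 * t₁ < τ + r := by
    refine lt_of_le_of_ne hz.2.1 fun h => ?_
    have hA0 : 0 ≤ A := by
      by_contra! hneg
      have := isMaxOn_iff.1 hB _ ht2S
      simp only at this
      nlinarith [sq_nonneg κ]
    have := hbot (τ, r) (by
      have := abs_lt.1 hlat
      rw [Metric.mem_ball, Prod.dist_eq, max_lt_iff, Real.dist_eq, Real.dist_eq, abs_lt, abs_lt]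
      simp only
      refine ⟨⟨?_, ?_⟩, ?_, ?_⟩ <;> linarith)
    simp only at this
    nlinarith [mul_nonneg hA0 (sq_nonneg (r - τ))]
  have hl := abs_lt.1 hlat
  obtain ⟨hτJ, hrJ⟩ := hSJ hz
  have d1 : HasDerivAt (fun s => Φ s r - (M + ε) * s - A * (r - s) ^ 2)
      (p τ r - (M + ε) * 1 - A * (2 * (r - τ) ^ 1 * (-1))) τ := by
    refine ((hp τ hτJ r hrJ).sub ((hasDerivAt_id τ).const_mul _)).sub
      (HasDerivAt.const_mul A ?_)
    exact ((hasDerivAt_id τ).const_sub r).pow 2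
  have d2 : HasDerivAt (fun s => Φ τ s - (M + ε) * τ - A * (s - τ) ^ 2)
      (q τ r - A * (2 * (r - τ) ^ 1 * 1)) r := by
    refine ((hq τ hτJ r hrJ).sub_const _).sub (HasDerivAt.const_mul A ?_)
    exact ((hasDerivAt_id r).sub_const τ).pow 2
  have e1 := d1.nonneg_of_eventually_le_left (by
    filter_upwards [Ioo_mem_nhdsLT (show max (τ - (κ - (r - τ))) (τ - (τ + r - 2 * t₁)) < τ from
      max_lt (by linarith) (by linarith))] with s hs
    have h1 := (le_max_left _ _).trans_lt hs.1
    have h2 := (le_max_right _ _).trans_lt hs.1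
    have h3 := hs.2
    have h4 := hz.2.2
    simp only at h4
    exact hmax' (s, r) ⟨abs_le.2 ⟨by simp only; linarith, by simp only; linarith⟩,
      by simp only; linarith, by simp only; linarith⟩)
  have e2 := d2.nonneg_of_eventually_le_left (by
    filter_upwards [Ioo_mem_nhdsLT (show max (r - (κ + (r - τ))) (r - (τ + r - 2 * t₁)) < r from
      max_lt (by linarith) (by linarith))] with s hs
    have h1 := (le_max_left _ _).trans_lt hs.1
    have h2 := (le_max_right _ _).trans_lt hs.1
    have h3 := hs.2
    have h4 := hz.2.2
    simp only at h4
    exact hmax' (τ, s) ⟨abs_le.2 ⟨by simp only; linarith, by simp only; linarith⟩,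
      by simp only; linarith, by simp only; linarith⟩)
  have := hpq τ hτJ r hrJ
  linarith

/-- Real-valued form of the regularity of `u` used below: classical differentiability, boundedness,
and quantitative anisotropic Hölder bounds for `u`, `Y u` and `Δ_v u`. -/
structure KinReg {d : ℕ} (α : ℝ) (I : Set ℝ) (u : Pt d → ℝ) (M H MY K : ℝ) : Prop where
  alpha_pos : 0 < α
  alpha_lt : α < 1
  lower : ∀ t ∈ I, ∀ s ≤ t, s ∈ I
  right : ∀ t ∈ I, ∃ δ, 0 < δ ∧ t + δ ∈ I
  H_nonneg : 0 ≤ H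
  K_nonneg : 0 ≤ K
  dt : ∀ t ∈ I, ∀ x v, DifferentiableAt ℝ (fun s => u (s, x, v)) t
  dx : ∀ t ∈ I, ∀ x v, DifferentiableAt ℝ (fun y => u (t, y, v)) x
  dv : ∀ t ∈ I, ∀ x v, DifferentiableAt ℝ (fun w => u (t, x, w)) v
  dvv : ∀ t ∈ I, ∀ x v, DifferentiableAt ℝ (fun w => Dv u (t, x, w)) v
  bound : ∀ t ∈ I, ∀ x v, |u (t, x, v)| ≤ M
  holder : ∀ t ∈ I, ∀ x v x' v',
    |u (t, x, v) - u (t, x', v')| ≤ H * (‖x - x'‖ ^ ((1 : ℝ) / 3) + ‖v - v'‖) ^ α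
  bound_Y : ∀ t ∈ I, ∀ x v, |Yop u (t, x, v)| ≤ MY
  holder_Y : ∀ t ∈ I, ∀ x v x' v',
    |Yop u (t, x, v) - Yop u (t, x', v')| ≤ K * (‖x - x'‖ ^ ((1 : ℝ) / 3) + ‖v - v'‖) ^ α
  holder_L : ∀ t ∈ I, ∀ x v x' v',
    |lapV u (t, x, v) - lapV u (t, x', v')| ≤ K * (‖x - x'‖ ^ ((1 : ℝ) / 3) + ‖v - v'‖) ^ α

namespace KinReg

variable {d : ℕ} {α : ℝ} {I : Set ℝ} {u : Pt d → ℝ} {M H MY K : ℝ}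

lemma continuousOn_characteristic (h : KinReg α I u M H MY K) (t₁ : ℝ) (x v : Ed d) :
    ContinuousOn (fun z : ℝ × ℝ => u (z.1, x - (z.2 - t₁) • v, v)) (I ×ˢ univ) := by
  rintro ⟨τ₀, r₀⟩ ⟨hτ₀, -⟩
  have hα := h.alpha_pos
  rw [ContinuousWithinAt, tendsto_iff_norm_sub_tendsto_zero]
  have h1 : Tendsto (fun z : ℝ × ℝ => H * (‖(x - (z.2 - t₁) • v) - (x - (r₀ - t₁) • v)‖ ^
      ((1 : ℝ) / 3) + ‖v - v‖) ^ α + |u (z.1, x - (r₀ - t₁) • v, v) - u (τ₀, x - (r₀ - t₁) • v, v)|)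
      (𝓝 (τ₀, r₀)) (𝓝 0) := by
    have c1 : Continuous fun z : ℝ × ℝ => H * (‖(x - (z.2 - t₁) • v) - (x - (r₀ - t₁) • v)‖ ^
      ((1 : ℝ) / 3) + ‖v - v‖) ^ α := by
      refine continuous_const.mul (Continuous.rpow_const ?_ fun _ => Or.inr hα.le)
      refine Continuous.add (Continuous.rpow_const (by fun_prop) fun _ => Or.inr (by norm_num)) ?_
      fun_prop
    have c2 : ContinuousAt (fun z : ℝ × ℝ => |u (z.1, x - (r₀ - t₁) • v, v) -
        u (τ₀, x - (r₀ - t₁) • v, v)|) (τ₀, r₀) := by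
      have c3 : ContinuousAt (fun s => u (s, x - (r₀ - t₁) • v, v)) τ₀ :=
        (h.dt τ₀ hτ₀ _ _).continuousAt
      have c4 : ContinuousAt (fun z : ℝ × ℝ => u (z.1, x - (r₀ - t₁) • v, v)) (τ₀, r₀) :=
        ContinuousAt.comp (f := Prod.fst) (x := (τ₀, r₀)) c3 continuousAt_fst
      exact (c4.sub continuousAt_const).abs
    have := (c1.tendsto (τ₀, r₀)).add c2.tendsto
    simpa [Real.zero_rpow hα.ne'] using this
  refine squeeze_zero' (Eventually.of_forall fun _ => norm_nonneg _) ?_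
    (h1.mono_left nhdsWithin_le_nhds)
  filter_upwards [self_mem_nhdsWithin] with z hz
  rw [Real.norm_eq_abs]
  calc _ ≤ |u (z.1, x - (z.2 - t₁) • v, v) - u (z.1, x - (r₀ - t₁) • v, v)| +
        |u (z.1, x - (r₀ - t₁) • v, v) - u (τ₀, x - (r₀ - t₁) • v, v)| := abs_sub_le _ _ _
    _ ≤ _ := by gcongr; exact h.holder z.1 hz.1 _ _ _ _

lemma hasDerivAt_characteristic (h : KinReg α I u M H MY K) {τ : ℝ} (hτ : τ ∈ I) (t₁ r : ℝ)
    (x v : Ed d) : HasDerivAt (fun s => u (τ, x - (s - t₁) • v, v))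
      (-Dx u (τ, x - (r - t₁) • v, v) v) r := by
  have h1 : HasDerivAt (fun s : ℝ => x - (s - t₁) • v) (-v) r := by
    have := (((hasDerivAt_id r).sub_const t₁).smul_const v).const_sub x
    rwa [one_smul] at this
  have h2 := (h.dx τ hτ (x - (r - t₁) • v) v).hasFDerivAt.comp_hasDerivAt r h1
  rw [map_neg] at h2
  exact h2

lemma transport_combination_le (h : KinReg α I u M H MY K) {t₁ t₂ : ℝ} (ht : t₁ ≤ t₂) (ht₂ : t₂ ∈ I)
    (σ σ' : ℝ) (x v x' v' : Ed d) {B : ℝ}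
    (hB : ∀ τ ∈ I, ∀ r, |r - t₁| ≤ 2 * (t₂ - t₁) → σ * Yop u (τ, x - (r - t₁) • v, v) +
      σ' * Yop u (τ, x' - (r - t₁) • v', v') ≤ B) :
    σ * (u (t₂, x - (t₂ - t₁) • v, v) - u (t₁, x, v)) +
      σ' * (u (t₂, x' - (t₂ - t₁) • v', v') - u (t₁, x', v')) ≤ B * (t₂ - t₁) := by
  rcases ht.eq_or_lt with rfl | hlt
  · simp
  obtain ⟨δ₀, hδ₀, hδI⟩ := h.right t₂ ht₂
  obtain ⟨δ, hδ, h1, h2⟩ : ∃ δ, 0 < δ ∧ δ ≤ δ₀ ∧ δ ≤ t₂ - t₁ :=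
    ⟨min δ₀ (t₂ - t₁), lt_min hδ₀ (by linarith), min_le_left _ _, min_le_right _ _⟩
  have hJ : ∀ τ ∈ Icc (t₁ - δ) (t₂ + δ), τ ∈ I := fun τ hτ =>
    h.lower _ hδI τ (by linarith [hτ.2])
  have hcont := fun x v => (h.continuousOn_characteristic t₁ x v).mono
    (show Icc (t₁ - δ) (t₂ + δ) ×ˢ Icc (t₁ - δ) (t₂ + δ) ⊆ I ×ˢ univ from
      fun z hz => ⟨hJ _ hz.1, mem_univ _⟩)
  have := diagonal_sub_le_of_sum_partial_le
    (Φ := fun τ r => σ * u (τ, x - (r - t₁) • v, v) + σ' * u (τ, x' - (r - t₁) • v', v'))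
    (p := fun τ r => σ * Dt u (τ, x - (r - t₁) • v, v) + σ' * Dt u (τ, x' - (r - t₁) • v', v'))
    (q := fun τ r => σ * (-Dx u (τ, x - (r - t₁) • v, v) v) +
      σ' * (-Dx u (τ, x' - (r - t₁) • v', v') v')) (M := B) ht hδ
    ((continuousOn_const.mul (hcont x v)).add (continuousOn_const.mul (hcont x' v')))
    (fun τ hτ r hr => ((h.dt τ (hJ τ hτ) _ _).hasDerivAt.const_mul σ).add
      ((h.dt τ (hJ τ hτ) _ _).hasDerivAt.const_mul σ'))
    (fun τ hτ r hr => ((h.hasDerivAt_characteristic (hJ τ hτ) t₁ r x v).const_mul σ).add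
      ((h.hasDerivAt_characteristic (hJ τ hτ) t₁ r x' v').const_mul σ'))
    (fun τ hτ r hr => by
      have := hB τ (hJ τ hτ) r (abs_le.2 ⟨by linarith [hr.1], by linarith [hr.2]⟩)
      simp only [Yop] at this
      linarith)
  simp only [sub_self, zero_smul, sub_zero] at this
  linarith

lemma abs_transport_le (h : KinReg α I u M H MY K) {t₁ t₂ : ℝ} (ht₁ : t₁ ∈ I) (ht₂ : t₂ ∈ I)
    (x v : Ed d) : |u (t₂, x - (t₂ - t₁) • v, v) - u (t₁, x, v)| ≤ MY * |t₂ - t₁| := by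
  have key : ∀ {t₁ t₂ : ℝ} (_ : t₁ ≤ t₂) (_ : t₂ ∈ I) (x : Ed d),
      |u (t₂, x - (t₂ - t₁) • v, v) - u (t₁, x, v)| ≤ MY * |t₂ - t₁| := by
    intro t₁ t₂ ht ht₂ x
    rw [abs_of_nonneg (sub_nonneg.2 ht)]
    have h1 := h.transport_combination_le ht ht₂ 1 0 x v x v (B := MY) fun τ hτ r _ => by
      linarith [(abs_le.1 (h.bound_Y τ hτ (x - (r - t₁) • v) v)).2]
    have h2 := h.transport_combination_le ht ht₂ (-1) 0 x v x v (B := MY) fun τ hτ r _ => by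
      linarith [(abs_le.1 (h.bound_Y τ hτ (x - (r - t₁) • v) v)).1]
    exact abs_le'.2 ⟨by linarith, by linarith⟩
  rcases le_total t₁ t₂ with ht | ht
  · exact key ht ht₂ x
  · have := key ht ht₁ (x - (t₂ - t₁) • v)
    rw [abs_sub_comm, abs_sub_comm t₂]
    rwa [show x - (t₂ - t₁) • v - (t₁ - t₂) • v = x by module] at this

lemma abs_transport_sub_transport_le (h : KinReg α I u M H MY K) {t₁ t₂ : ℝ} (ht₁ : t₁ ∈ I)
    (ht₂ : t₂ ∈ I) (x v x' v' : Ed d) :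
    |(u (t₂, x - (t₂ - t₁) • v, v) - u (t₁, x, v)) -
      (u (t₂, x' - (t₂ - t₁) • v', v') - u (t₁, x', v'))| ≤
      K * ((‖x - x'‖ + 3 * |t₂ - t₁| * ‖v - v'‖) ^ ((1 : ℝ) / 3) + ‖v - v'‖) ^ α * |t₂ - t₁| := by
  have hK := h.K_nonneg
  have hα := h.alpha_pos.le
  have key : ∀ {t₁ t₂ : ℝ} (_ : t₁ ≤ t₂) (_ : t₂ ∈ I) (x x' : Ed d),
      |(u (t₂, x - (t₂ - t₁) • v, v) - u (t₁, x, v)) -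
      (u (t₂, x' - (t₂ - t₁) • v', v') - u (t₁, x', v'))| ≤
      K * ((‖x - x'‖ + 2 * |t₂ - t₁| * ‖v - v'‖) ^ ((1 : ℝ) / 3) + ‖v - v'‖) ^ α * |t₂ - t₁| := by
    intro t₁ t₂ ht ht₂ x x'
    have hY : ∀ τ ∈ I, ∀ r, |r - t₁| ≤ 2 * (t₂ - t₁) →
        |Yop u (τ, x - (r - t₁) • v, v) - Yop u (τ, x' - (r - t₁) • v', v')| ≤
        K * ((‖x - x'‖ + 2 * |t₂ - t₁| * ‖v - v'‖) ^ ((1 : ℝ) / 3) + ‖v - v'‖) ^ α := by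
      intro τ hτ r hr
      refine (h.holder_Y τ hτ _ _ _ _).trans ?_
      have : ‖x - (r - t₁) • v - (x' - (r - t₁) • v')‖ ≤
          ‖x - x'‖ + 2 * |t₂ - t₁| * ‖v - v'‖ := by
        rw [show x - (r - t₁) • v - (x' - (r - t₁) • v') = (x - x') - (r - t₁) • (v - v') by module]
        refine (norm_sub_le _ _).trans ?_
        rw [norm_smul, Real.norm_eq_abs, abs_of_nonneg (sub_nonneg.2 ht)]
        gcongr
      gcongr
    rw [abs_of_nonneg (sub_nonneg.2 ht)] at hY ⊢
    have h1 := h.transport_combination_le ht ht₂ 1 (-1) x v x' v' fun τ hτ r hr => by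
      have := (abs_le.1 (hY τ hτ r hr)).2
      rw [one_mul, neg_one_mul, ← sub_eq_add_neg]
      exact this
    have h2 := h.transport_combination_le ht ht₂ (-1) 1 x v x' v' fun τ hτ r hr => by
      have := neg_le.1 (abs_le.1 (hY τ hτ r hr)).1
      rw [one_mul, neg_one_mul, neg_add_eq_sub, ← neg_sub]
      exact this
    exact abs_le'.2 ⟨by linarith, by linarith⟩
  rcases le_total t₁ t₂ with ht | ht
  · refine (key ht ht₂ x x').trans ?_
    gcongr
    norm_num
  · have := key ht ht₁ (x - (t₂ - t₁) • v) (x' - (t₂ - t₁) • v')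
    rw [show x - (t₂ - t₁) • v - (t₁ - t₂) • v = x by module,
      show x' - (t₂ - t₁) • v' - (t₁ - t₂) • v' = x' by module, abs_sub_comm t₁] at this
    have e : (u (t₂, x - (t₂ - t₁) • v, v) - u (t₁, x, v)) -
      (u (t₂, x' - (t₂ - t₁) • v', v') - u (t₁, x', v')) =
      -((u (t₁, x, v) - u (t₂, x - (t₂ - t₁) • v, v)) -
      (u (t₁, x', v') - u (t₂, x' - (t₂ - t₁) • v', v'))) := by ring
    rw [e, abs_neg]
    refine this.trans ?_
    have : ‖x - (t₂ - t₁) • v - (x' - (t₂ - t₁) • v')‖ + 2 * |t₂ - t₁| * ‖v - v'‖ ≤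
          ‖x - x'‖ + 3 * |t₂ - t₁| * ‖v - v'‖ := by
      rw [show x - (t₂ - t₁) • v - (x' - (t₂ - t₁) • v') = (x - x') - (t₂ - t₁) • (v - v') by module]
      have := norm_sub_le (x - x') ((t₂ - t₁) • (v - v'))
      rw [norm_smul, Real.norm_eq_abs] at this
      linarith
    gcongr

/-- Scaled form of the comparison of increments along two characteristics. -/
lemma abs_transport_sub_transport_le_scaled (h : KinReg α I u M H MY K) {t₁ t₂ : ℝ} (ht₁ : t₁ ∈ I)
    (ht₂ : t₂ ∈ I) (x v x' v' : Ed d) {n r : ℝ} (hn : 1 ≤ n) (hr : 0 ≤ r)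
    (ht : |t₂ - t₁| ≤ n * r ^ 2) (hx : ‖x - x'‖ ≤ n * r ^ 3) (hv : ‖v - v'‖ ≤ n * r) :
    |(u (t₂, x - (t₂ - t₁) • v, v) - u (t₁, x, v)) -
      (u (t₂, x' - (t₂ - t₁) • v', v') - u (t₁, x', v'))| ≤ 5 * n ^ 3 * K * r ^ (2 + α) := by
  have hK := h.K_nonneg
  have hα := h.alpha_pos.le
  have hα1 := h.alpha_lt.le
  refine (h.abs_transport_sub_transport_le ht₁ ht₂ x v x' v').trans ?_
  have hn0 : 0 ≤ n := by linarith
  have h1 : (‖x - x'‖ + 3 * |t₂ - t₁| * ‖v - v'‖) ^ ((1 : ℝ) / 3) ≤ 4 * n ^ 2 * r := by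
    have e : ‖x - x'‖ + 3 * |t₂ - t₁| * ‖v - v'‖ ≤ (4 * n ^ 2 * r) ^ 3 := by
      calc _ ≤ n * r ^ 3 + 3 * (n * r ^ 2) * (n * r) := by gcongr
        _ = (n + 3 * n ^ 2) * r ^ 3 := by ring
        _ ≤ (4 * n ^ 2) ^ 3 * r ^ 3 := by
          gcongr
          have a1 : n ≤ n ^ 2 := by nlinarith
          have a2 : n ^ 2 ≤ n ^ 6 := pow_le_pow_right₀ hn (by norm_num)
          nlinarith
        _ = _ := by ring
    calc _ ≤ ((4 * n ^ 2 * r) ^ 3) ^ ((1 : ℝ) / 3) := by gcongr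
      _ = _ := by
        rw [← Real.rpow_natCast, ← Real.rpow_mul (by positivity)]
        norm_num
  have h2 : ((‖x - x'‖ + 3 * |t₂ - t₁| * ‖v - v'‖) ^ ((1 : ℝ) / 3) + ‖v - v'‖) ^ α ≤
      5 * n ^ 2 * r ^ α := by
    calc _ ≤ (5 * n ^ 2 * r) ^ α := by
          gcongr
          have : n * r ≤ n ^ 2 * r := by gcongr; nlinarith
          linarith
      _ = (5 * n ^ 2) ^ α * r ^ α := Real.mul_rpow (by positivity) hr
      _ ≤ (5 * n ^ 2) ^ (1 : ℝ) * r ^ α := by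
          gcongr
          nlinarith
      _ = _ := by rw [Real.rpow_one]
  calc _ ≤ K * (5 * n ^ 2 * r ^ α) * (n * r ^ 2) := by gcongr
    _ = 5 * n ^ 3 * K * (r ^ (2 : ℝ) * r ^ α) := by rw [Real.rpow_two]; ring
    _ = _ := by rw [← Real.rpow_add_of_nonneg hr (by norm_num) hα]

lemma abs_thirdDiff_velocity_le (h : KinReg α I u M H MY K) {t : ℝ} (ht : t ∈ I) (x v : Ed d)
    (i j k : Fin d) {a b c r : ℝ} (ha : |a| ≤ r) (hb : |b| ≤ r) (hc : |c| ≤ r) :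
    |thirdDiff (fun w => u (t, x, w)) v (a • EuclideanSpace.single i 1)
      (b • EuclideanSpace.single j 1) (c • EuclideanSpace.single k 1)| ≤
      72 / ((2 + α) * (1 - α)) * K * r ^ (2 + α) := by
  have hK := h.K_nonneg
  have hα := h.alpha_pos
  have hα1 := h.alpha_lt
  have hr := (abs_nonneg a).trans ha
  refine (abs_thirdDiff_le_of_laplacian_holder (f := fun w => u (t, x, w)) (K := K) (α := α)
    (β := (2 + α) / 3) (fun v => h.dv t ht x v) (fun v => h.dvv t ht x v) (h.bound t ht x)
    hα hα1 hK (by ring) (fun p q => ?_) v i j k a b c).trans ?_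
  · have := h.holder_L t ht x p x q
    rwa [sub_self, norm_zero, Real.zero_rpow (by norm_num), zero_add] at this
  · have e : 8 / ((2 + α) / 3 * (1 - (2 + α) / 3)) = 72 / ((2 + α) * (1 - α)) := by
      rw [show (2 + α) / 3 * (1 - (2 + α) / 3) = (2 + α) * (1 - α) / 9 by ring]
      field_simp
      norm_num
    have hpos : 0 < 1 - α := by linarith
    rw [e]
    calc _ ≤ 72 / ((2 + α) * (1 - α)) * K * (r * r * r) ^ ((2 + α) / 3) := by gcongr
      _ = _ := by
        congr 1
        rw [show r * r * r = r ^ (3 : ℝ) by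
          rw [show (3 : ℝ) = (3 : ℕ) by norm_num, Real.rpow_natCast]; ring, ← Real.rpow_mul hr]
        congr 1; ring

end KinReg

lemma le_of_doubling {F : ℝ → ℝ → ℝ} {L D β q : ℝ} (hD : 0 ≤ D) (hq1 : 1 < q)
    (hq : (2 : ℝ) ^ β < q) (hL : ∀ x y, F x y ≤ L)
    (hF : ∀ x y, F x y ≤ F x (2 * y) / q + D * |y| ^ β) (x y : ℝ) :
    F x y ≤ D / (1 - 2 ^ β / q) * |y| ^ β := by
  have hq0 : 0 < q := by linarith
  have hlt : 0 < 1 - (2 : ℝ) ^ β / q := sub_pos.2 ((div_lt_one hq0).2 hq)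
  have key : ∀ n : ℕ, ∀ y, F x y ≤ L * q⁻¹ ^ n + D / (1 - 2 ^ β / q) * |y| ^ β := by
    intro n
    induction n with
    | zero =>
      intro y
      have : 0 ≤ D / (1 - 2 ^ β / q) * |y| ^ β := by positivity
      linarith [hL x y]
    | succ n ih =>
      intro y
      have h1 := ih (2 * y)
      rw [abs_mul, Real.mul_rpow (abs_nonneg _) (abs_nonneg _), abs_two] at h1
      have h2 : F x (2 * y) / q ≤ (L * q⁻¹ ^ n + D / (1 - 2 ^ β / q) * (2 ^ β * |y| ^ β)) / q := by
        gcongr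
      have h3 : (L * q⁻¹ ^ n + D / (1 - 2 ^ β / q) * (2 ^ β * |y| ^ β)) / q + D * |y| ^ β =
          L * q⁻¹ ^ (n + 1) + D / (1 - 2 ^ β / q) * |y| ^ β := by
        rw [pow_succ]
        generalize (2 : ℝ) ^ β = p at *
        generalize |y| ^ β = Y
        have e : D = D / (1 - p / q) * (1 - p / q) := (div_mul_cancel₀ D hlt.ne').symm
        generalize D / (1 - p / q) = Z at *
        rw [e]
        field_simp
        ring
      linarith [hF x y]
  have ht : Tendsto (fun n : ℕ => L * q⁻¹ ^ n + D / (1 - 2 ^ β / q) * |y| ^ β) atTop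
      (𝓝 (L * 0 + D / (1 - 2 ^ β / q) * |y| ^ β)) :=
    ((tendsto_pow_atTop_nhds_zero_of_lt_one (by positivity) (inv_lt_one_of_one_lt₀ hq1)).const_mul
      L).add_const _
  rw [mul_zero, zero_add] at ht
  exact ge_of_tendsto' ht fun n => key n y

/-- A bounded function on the line whose third differences are of order `|y| ^ β`, `β < 1`, is
`β`-Hölder continuous. -/
lemma abs_sub_le_of_third_difference {f : ℝ → ℝ} {L B β : ℝ} (hβ0 : 0 < β) (hβ1 : β < 1)
    (hB : 0 ≤ B) (hf : ∀ x, |f x| ≤ L)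
    (h3 : ∀ x y, |f (x + 3 * y) - 3 * f (x + 2 * y) + 3 * f (x + y) - f x| ≤ B * |y| ^ β)
    (x y : ℝ) : |f (x + y) - f x| ≤ 1 / (1 - 2 ^ β / 2) * B * |y| ^ β := by
  have hL0 : 0 ≤ L := (abs_nonneg _).trans (hf 0)
  have h2β : (2 : ℝ) ^ β < 2 := by
    calc (2 : ℝ) ^ β < 2 ^ (1 : ℝ) := Real.rpow_lt_rpow_of_exponent_lt (by norm_num) hβ1
      _ = 2 := Real.rpow_one 2
  have second : ∀ x y, |f (x + 2 * y) - 2 * f (x + y) + f x| ≤ 2 * B * |y| ^ β := by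
    intro x y
    have h := le_of_doubling (F := fun x y => |f (x + 2 * y) - 2 * f (x + y) + f x|) (L := 4 * L)
      (D := B) (β := β) (q := 4) hB (by norm_num) (by linarith) (fun x y => by
        have a1 := abs_le.1 (hf (x + 2 * y))
        have a2 := abs_le.1 (hf (x + y))
        have a3 := abs_le.1 (hf x)
        exact abs_le.2 ⟨by linarith, by linarith⟩) (fun x y => by
        have b1 := abs_le.1 (h3 x y)
        have b2 := abs_le.1 (h3 (x + y) y)
        rw [show x + y + 3 * y = x + 2 * (2 * y) by ring, show x + y + 2 * y = x + 3 * y by ring,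
          show x + y + y = x + 2 * y by ring] at b2
        have b3 := le_abs_self (f (x + 2 * (2 * y)) - 2 * f (x + 2 * y) + f x)
        have b4 := neg_le_abs (f (x + 2 * (2 * y)) - 2 * f (x + 2 * y) + f x)
        exact abs_le.2 ⟨by linarith, by linarith⟩) x y
    refine h.trans ?_
    have hy : 0 ≤ |y| ^ β := by positivity
    gcongr
    rw [div_le_iff₀ (by linarith)]
    nlinarith
  have h := le_of_doubling (F := fun x y => |f (x + y) - f x|) (L := 2 * L)
    (D := B) (β := β) (q := 2) hB (by norm_num) h2β (fun x y => by
      have a2 := abs_le.1 (hf (x + y))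
      have a3 := abs_le.1 (hf x)
      exact abs_le.2 ⟨by linarith, by linarith⟩) (fun x y => by
      have b1 := abs_le.1 (second x y)
      have b3 := le_abs_self (f (x + 2 * y) - f x)
      have b4 := neg_le_abs (f (x + 2 * y) - f x)
      exact abs_le.2 ⟨by linarith, by linarith⟩) x y
  rw [one_div_mul_eq_div]
  exact h

lemma abs_third_difference_le_of_relations {f₀ f₁ f₂ f₃ : ℤ → ℝ} {E : ℝ}
    (h : ∀ m j : ℤ, 0 ≤ j → j ≤ 11 →
      |f₃ (m + 3 * j) - 3 * f₂ (m + 2 * j) + 3 * f₁ (m + j) - f₀ m| ≤ E) :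
    |f₃ 18 - 3 * f₃ 12 + 3 * f₃ 6 - f₃ 0| ≤ 8 * E := by
  have a1 := abs_le.1 (h 0 0 (by norm_num) (by norm_num))
  have a2 := abs_le.1 (h 0 2 (by norm_num) (by norm_num))
  have a3 := abs_le.1 (h (-3) 3 (by norm_num) (by norm_num))
  have a4 := abs_le.1 (h (-3) 5 (by norm_num) (by norm_num))
  have a5 := abs_le.1 (h (-12) 6 (by norm_num) (by norm_num))
  have a6 := abs_le.1 (h (-12) 8 (by norm_num) (by norm_num))
  have a7 := abs_le.1 (h (-15) 9 (by norm_num) (by norm_num))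
  have a8 := abs_le.1 (h (-15) 11 (by norm_num) (by norm_num))
  norm_num at a1 a2 a3 a4 a5 a6 a7 a8
  exact abs_le.2 ⟨by linarith, by linarith⟩

namespace KinReg

variable {d : ℕ} {α : ℝ} {I : Set ℝ} {u : Pt d → ℝ} {M H MY K : ℝ}

/-- Comparison of the four velocities `v + n w`, `0 ≤ n ≤ 3`, along their characteristics. -/
lemma abs_skew_third_difference_le (h : KinReg α I u M H MY K) {t : ℝ} (ht : t ∈ I) (x v : Ed d)
    (i : Fin d) (c : ℝ) {j : ℝ} (hj0 : 0 ≤ j) (hj : j ≤ 11) :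
    |u (t, x - (3 * j * |c| ^ 2 * c) • EuclideanSpace.single i 1,
        v + (3 * c) • EuclideanSpace.single i 1)
      - 3 * u (t, x - (2 * j * |c| ^ 2 * c) • EuclideanSpace.single i 1,
        v + (2 * c) • EuclideanSpace.single i 1)
      + 3 * u (t, x - (j * |c| ^ 2 * c) • EuclideanSpace.single i 1,
        v + c • EuclideanSpace.single i 1) - u (t, x, v)| ≤
      (72 / ((2 + α) * (1 - α)) + 7 * (5 * 33 ^ 3)) * K * |c| ^ (2 + α) := by
  have hc := abs_nonneg c
  have ht2 : t - j * |c| ^ 2 ∈ I := h.lower t ht _ (by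
    have : 0 ≤ j * |c| ^ 2 := by positivity
    linarith)
  obtain ⟨U, hU⟩ : ∃ U : Ed d → ℝ, ∀ w, U w = u (t - j * |c| ^ 2, x + (j * |c| ^ 2) • v, w) :=
    ⟨_, fun _ => rfl⟩
  have tr : ∀ n : ℝ, 0 ≤ n → n ≤ 3 →
      |(U (v + (n * c) • EuclideanSpace.single i 1) -
        u (t, x - (n * j * |c| ^ 2 * c) • EuclideanSpace.single i 1,
          v + (n * c) • EuclideanSpace.single i 1)) - (U v - u (t, x, v))| ≤
      5 * 33 ^ 3 * K * |c| ^ (2 + α) := by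
    intro n hn0 hn
    have := h.abs_transport_sub_transport_le_scaled ht ht2
      (x - (n * j * |c| ^ 2 * c) • EuclideanSpace.single i 1)
      (v + (n * c) • EuclideanSpace.single i 1) x v (n := 33) (r := |c|) (by norm_num) hc
      (by
        rw [show t - j * |c| ^ 2 - t = -(j * |c| ^ 2) by ring, abs_neg, abs_of_nonneg (by positivity)]
        gcongr; linarith)
      (by
        rw [sub_sub_cancel_left, norm_neg, norm_smul, PiLp.norm_single, norm_one, mul_one,
          Real.norm_eq_abs, abs_mul, abs_of_nonneg (by positivity)]
        calc n * j * |c| ^ 2 * |c| ≤ 3 * 11 * |c| ^ 2 * |c| := by gcongr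
          _ = _ := by ring)
      (by
        rw [add_sub_cancel_left, norm_smul, PiLp.norm_single, norm_one, mul_one,
          Real.norm_eq_abs, abs_mul, abs_of_nonneg hn0]
        gcongr; linarith)
    rw [hU, hU]
    convert this using 6
    · congr 2
      module
    · congr 2
      module
  have t3 := tr 3 (by norm_num) (by norm_num)
  have t2 := tr 2 (by norm_num) (by norm_num)
  have t1 := tr 1 (by norm_num) (by norm_num)
  rw [one_mul, one_mul] at t1
  have td := h.abs_thirdDiff_velocity_le ht2 (x + (j * |c| ^ 2) • v)
    (v + (3 / 2 * c) • EuclideanSpace.single i 1) i i i (a := c / 2) (b := c / 2) (c := c / 2)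
    (r := |c|) (by rw [abs_div, abs_two]; linarith) (by rw [abs_div, abs_two]; linarith)
    (by rw [abs_div, abs_two]; linarith)
  have e : thirdDiff (fun w => u (t - j * |c| ^ 2, x + (j * |c| ^ 2) • v, w))
      (v + (3 / 2 * c) • EuclideanSpace.single i 1) ((c / 2) • EuclideanSpace.single i 1)
      ((c / 2) • EuclideanSpace.single i 1) ((c / 2) • EuclideanSpace.single i 1) =
      U (v + (3 * c) • EuclideanSpace.single i 1) - 3 * U (v + (2 * c) • EuclideanSpace.single i 1)
      + 3 * U (v + c • EuclideanSpace.single i 1) - U v := by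
    simp only [thirdDiff, ← hU]
    generalize (EuclideanSpace.single i 1 : Ed d) = ε
    rw [show v + (3 / 2 * c) • ε + (c / 2) • ε + (c / 2) • ε + (c / 2) • ε = v + (3 * c) • ε by module,
      show v + (3 / 2 * c) • ε + (c / 2) • ε + (c / 2) • ε - (c / 2) • ε = v + (2 * c) • ε by module,
      show v + (3 / 2 * c) • ε + (c / 2) • ε - (c / 2) • ε + (c / 2) • ε = v + (2 * c) • ε by module,
      show v + (3 / 2 * c) • ε + (c / 2) • ε - (c / 2) • ε - (c / 2) • ε = v + c • ε by module,
      show v + (3 / 2 * c) • ε - (c / 2) • ε + (c / 2) • ε + (c / 2) • ε = v + (2 * c) • ε by module,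
      show v + (3 / 2 * c) • ε - (c / 2) • ε + (c / 2) • ε - (c / 2) • ε = v + c • ε by module,
      show v + (3 / 2 * c) • ε - (c / 2) • ε - (c / 2) • ε + (c / 2) • ε = v + c • ε by module,
      show v + (3 / 2 * c) • ε - (c / 2) • ε - (c / 2) • ε - (c / 2) • ε = v by module]
    ring
  rw [e] at td
  rw [add_mul, add_mul, mul_assoc 7, mul_assoc 7]
  rw [abs_le] at t1 t2 t3 td ⊢
  constructor <;> linarith

end KinReg

lemma exists_cube_eq (y : ℝ) : ∃ c : ℝ, |c| ^ 2 * c = y := by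
  have e : (|y| ^ ((1 : ℝ) / 3)) ^ 3 = |y| := by
    rw [← Real.rpow_natCast, ← Real.rpow_mul (abs_nonneg y)]
    norm_num
  have h0 : 0 ≤ |y| ^ ((1 : ℝ) / 3) := by positivity
  rcases le_total 0 y with hy | hy
  · refine ⟨|y| ^ ((1 : ℝ) / 3), ?_⟩
    rw [abs_of_nonneg h0, ← pow_succ, e, abs_of_nonneg hy]
  · refine ⟨-|y| ^ ((1 : ℝ) / 3), ?_⟩
    rw [abs_neg, abs_of_nonneg h0, mul_neg, ← pow_succ, e, abs_of_nonpos hy, neg_neg]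

lemma sum_smul_single {d : ℕ} (y : Ed d) :
    ∑ l, y l • (EuclideanSpace.single l 1 : Ed d) = y := by
  simpa using (EuclideanSpace.basisFun (Fin d) ℝ).sum_repr y

/-- Coordinatewise increments control arbitrary increments. -/
lemma abs_add_sub_le_of_coordinates {d : ℕ} {g : Ed d → ℝ} {r E : ℝ}
    (hg : ∀ x i s, |s| ≤ r → |g (x + s • EuclideanSpace.single i 1) - g x| ≤ E) (x y : Ed d)
    (hy : ‖y‖ ≤ r) : |g (x + y) - g x| ≤ d * E := by
  have key : ∀ s : Finset (Fin d),
      |g (x + ∑ l ∈ s, y l • EuclideanSpace.single l 1) - g x| ≤ s.card * E := by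
    intro s
    induction s using Finset.induction_on with
    | empty => simp
    | insert a s ha ih =>
      rw [Finset.sum_insert ha, Finset.card_insert_of_notMem ha, add_comm (y a • _), ← add_assoc]
      have h1 := hg (x + ∑ l ∈ s, y l • EuclideanSpace.single l 1) a (y a)
        ((PiLp.norm_apply_le y a).trans hy)
      refine (abs_sub_le _ _ _).trans ((add_le_add h1 ih).trans ?_)
      push_cast
      linarith
  have := key Finset.univ
  rwa [Finset.card_univ, Fintype.card_fin, sum_smul_single] at this

namespace KinReg

variable {d : ℕ} {α : ℝ} {I : Set ℝ} {u : Pt d → ℝ} {M H MY K : ℝ}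

lemma abs_third_difference_position_le (h : KinReg α I u M H MY K) {t : ℝ} (ht : t ∈ I)
    (x v : Ed d) (i : Fin d) (y : ℝ) :
    |u (t, x + (3 * y) • EuclideanSpace.single i 1, v)
      - 3 * u (t, x + (2 * y) • EuclideanSpace.single i 1, v)
      + 3 * u (t, x + y • EuclideanSpace.single i 1, v) - u (t, x, v)| ≤
      8 * (72 / ((2 + α) * (1 - α)) + 7 * (5 * 33 ^ 3)) * K * |y| ^ ((2 + α) / 3) := by
  have hα := h.alpha_pos
  have hα1 : 0 < 1 - α := by linarith [h.alpha_lt]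
  have hK := h.K_nonneg
  obtain ⟨c, hc⟩ := exists_cube_eq (-(y / 6))
  have hcy : |c| ^ (2 + α) ≤ |y| ^ ((2 + α) / 3) := by
    have h1 : |c| ^ 3 ≤ |y| := by
      have : |c| ^ 3 = |y| / 6 := by
        have := congrArg abs hc
        rw [abs_mul, abs_pow, abs_abs, ← pow_succ, abs_neg, abs_div] at this
        rw [this]
        norm_num
      linarith [abs_nonneg y]
    calc |c| ^ (2 + α) = (|c| ^ 3) ^ ((2 + α) / 3) := by
          rw [← Real.rpow_natCast, ← Real.rpow_mul (abs_nonneg c)]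
          congr 1
          push_cast
          ring
      _ ≤ _ := by gcongr
  have key := abs_third_difference_le_of_relations
    (f₀ := fun m => u (t, x - (m * |c| ^ 2 * c) • EuclideanSpace.single i 1,
      v - (3 * c) • EuclideanSpace.single i 1))
    (f₁ := fun m => u (t, x - (m * |c| ^ 2 * c) • EuclideanSpace.single i 1,
      v - (2 * c) • EuclideanSpace.single i 1))
    (f₂ := fun m => u (t, x - (m * |c| ^ 2 * c) • EuclideanSpace.single i 1,
      v - c • EuclideanSpace.single i 1))
    (f₃ := fun m => u (t, x - (m * |c| ^ 2 * c) • EuclideanSpace.single i 1, v))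
    (E := (72 / ((2 + α) * (1 - α)) + 7 * (5 * 33 ^ 3)) * K * |c| ^ (2 + α)) (by
      intro m j hj0 hj
      have := h.abs_skew_third_difference_le ht
        (x - (m * |c| ^ 2 * c) • EuclideanSpace.single i 1)
        (v - (3 * c) • EuclideanSpace.single i 1) i c (j := j) (by exact_mod_cast hj0)
        (by exact_mod_cast hj)
      simp only [Int.cast_add, Int.cast_mul, Int.cast_ofNat]
      generalize (EuclideanSpace.single i 1 : Ed d) = ε at *
      rw [show x - (m * |c| ^ 2 * c) • ε - (3 * j * |c| ^ 2 * c) • ε =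
          x - ((m + 3 * j) * |c| ^ 2 * c) • ε by module,
        show x - (m * |c| ^ 2 * c) • ε - (2 * j * |c| ^ 2 * c) • ε =
          x - ((m + 2 * j) * |c| ^ 2 * c) • ε by module,
        show x - (m * |c| ^ 2 * c) • ε - (j * |c| ^ 2 * c) • ε =
          x - ((m + j) * |c| ^ 2 * c) • ε by module,
        show v - (3 * c) • ε + (3 * c) • ε = v by module,
        show v - (3 * c) • ε + (2 * c) • ε = v - c • ε by module,
        show v - (3 * c) • ε + c • ε = v - (2 * c) • ε by module] at this
      exact this)
  simp only [Int.cast_ofNat, Int.cast_zero, mul_assoc, hc] at key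
  rw [show (18 : ℝ) * -(y / 6) = -(3 * y) by ring, show (12 : ℝ) * -(y / 6) = -(2 * y) by ring,
    show (6 : ℝ) * -(y / 6) = -y by ring] at key
  simp only [zero_mul, zero_smul, sub_zero, neg_smul, sub_neg_eq_add] at key
  refine key.trans ?_
  simp only [← mul_assoc]
  gcongr

lemma abs_sub_position_le (h : KinReg α I u M H MY K) {t : ℝ} (ht : t ∈ I) (x v y : Ed d) :
    |u (t, x + y, v) - u (t, x, v)| ≤
      d * (1 / (1 - 2 ^ ((2 + α) / 3) / 2) *
        (8 * (72 / ((2 + α) * (1 - α)) + 7 * (5 * 33 ^ 3)) * K)) * ‖y‖ ^ ((2 + α) / 3) := by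
  have hα := h.alpha_pos
  have hα1 : 0 < 1 - α := by linarith [h.alpha_lt]
  have hK := h.K_nonneg
  have hB : 0 ≤ 8 * (72 / ((2 + α) * (1 - α)) + 7 * (5 * 33 ^ 3)) * K := by positivity
  have hA : 0 ≤ 1 / (1 - (2 : ℝ) ^ ((2 + α) / 3) / 2) := by
    have : (2 : ℝ) ^ ((2 + α) / 3) ≤ 2 ^ (1 : ℝ) :=
      Real.rpow_le_rpow_of_exponent_le (by norm_num) (by linarith)
    rw [Real.rpow_one] at this
    exact one_div_nonneg.2 (by linarith)
  have coord : ∀ (x : Ed d) (i : Fin d) (s : ℝ),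
      |u (t, x + s • EuclideanSpace.single i 1, v) - u (t, x, v)| ≤
      1 / (1 - 2 ^ ((2 + α) / 3) / 2) *
        (8 * (72 / ((2 + α) * (1 - α)) + 7 * (5 * 33 ^ 3)) * K) * |s| ^ ((2 + α) / 3) := by
    intro x i s
    have := abs_sub_le_of_third_difference
      (f := fun s => u (t, x + s • EuclideanSpace.single i 1, v))
      (β := (2 + α) / 3) (by linarith) (by linarith) hB (fun s => h.bound t ht _ v)
      (fun s y => by
        have := h.abs_third_difference_position_le ht (x + s • EuclideanSpace.single i 1) v i y
        simpa only [add_assoc, ← add_smul] using this) 0 s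
    simpa only [zero_add, zero_smul, add_zero] using this
  have hA0 := mul_nonneg hA hB
  rw [mul_assoc]
  refine abs_add_sub_le_of_coordinates (g := fun x => u (t, x, v)) (r := ‖y‖)
    (fun x i s hs => (coord x i s).trans ?_) x y le_rfl
  gcongr

end KinReg

/-- Centered mixed second difference of `f` at `v` with half-steps `a`, `b`. -/
def mixedDiff {E : Type*} [AddCommGroup E] (f : E → ℝ) (v a b : E) : ℝ :=
  f (v + a + b) - f (v + a - b) - f (v - a + b) + f (v - a - b)

lemma thirdDiff_eq_mixedDiff_sub {E : Type*} [AddCommGroup E] (f : E → ℝ) (v a b c : E) :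
    thirdDiff f v a b c = mixedDiff f (v + c) a b - mixedDiff f (v - c) a b := by
  simp only [thirdDiff, mixedDiff]; abel_nf

lemma mixedDiff_double {E : Type*} [AddCommGroup E] [Module ℝ E] (f : E → ℝ) (v a b : E) :
    mixedDiff f v ((2 : ℝ) • a) ((2 : ℝ) • b) = mixedDiff f (v + a + b) a b +
      mixedDiff f (v + a - b) a b + mixedDiff f (v - a + b) a b + mixedDiff f (v - a - b) a b := by
  simp only [mixedDiff, two_smul]; abel_nf

lemma tendsto_mixedDiff_div {E : Type*} [NormedAddCommGroup E] [NormedSpace ℝ E] {f : E → ℝ}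
    (hf : Differentiable ℝ f) (hf' : Differentiable ℝ (fderiv ℝ f)) (v a b : E) :
    Tendsto (fun s : ℝ => mixedDiff f v (s • a) (s • b) / (4 * s ^ 2)) (𝓝[≠] 0)
      (𝓝 (fderiv ℝ (fderiv ℝ f) v a b)) := by
  have hsym := second_derivative_symmetric (fun y => (hf y).hasFDerivAt) (hf' v).hasFDerivAt a b
  have h1 := ((tendsto_second_diff_fderiv hf hf' v (a + b)).sub
    (tendsto_second_diff_fderiv hf hf' v (a - b))).div_const 4
  have e : (fderiv ℝ (fderiv ℝ f) v (a + b) (a + b) - fderiv ℝ (fderiv ℝ f) v (a - b) (a - b)) / 4 =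
      fderiv ℝ (fderiv ℝ f) v a b := by
    simp only [map_add, map_sub, add_apply, sub_apply, hsym]
    ring
  rw [e] at h1
  refine h1.congr fun s => ?_
  rw [← sub_div, div_div, mul_comm (s ^ 2)]
  congr 1
  simp only [mixedDiff, smul_add, smul_sub]
  rw [show v + (s • a - s • b) = v + s • a - s • b by abel, show v - (s • a - s • b) = v - s • a + s • b by abel,
    show v + (s • a + s • b) = v + s • a + s • b by abel, show v - (s • a + s • b) = v - s • a - s • b by abel]
  ring

lemma abs_sub_le_of_halving {q : ℝ → ℝ} {L κ α : ℝ} (hα : 0 < α) (hκ : 0 ≤ κ)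
    (hq : Tendsto q (𝓝[≠] 0) (𝓝 L)) (h : ∀ s, 0 < s → |q (2 * s) - q s| ≤ κ * s ^ α) {s : ℝ}
    (hs : 0 < s) : |L - q s| ≤ κ / (2 ^ α - 1) * s ^ α := by
  have h2 : 0 < (2 : ℝ) ^ α - 1 := sub_pos.2 (Real.one_lt_rpow (by norm_num) hα)
  have key : ∀ n : ℕ, ∀ s, 0 < s → |q (s * 2⁻¹ ^ n) - q s| ≤ κ / (2 ^ α - 1) * s ^ α := by
    intro n
    induction n with
    | zero => intro s hs; simp; positivity
    | succ n ih =>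
      intro s hs
      have h1 := ih (s / 2) (by positivity)
      have h3 := h (s / 2) (by positivity)
      rw [mul_div_cancel₀ s two_ne_zero, abs_sub_comm] at h3
      rw [show s * 2⁻¹ ^ (n + 1) = s / 2 * 2⁻¹ ^ n by rw [pow_succ]; ring]
      refine (abs_sub_le _ _ _).trans ((add_le_add h1 h3).trans (le_of_eq ?_))
      have e : s ^ α = 2 ^ α * (s / 2) ^ α := by
        rw [← Real.mul_rpow (by norm_num) (by positivity), mul_div_cancel₀ s two_ne_zero]
      rw [e]
      field_simp
      ring
  have ht : Tendsto (fun n : ℕ => s * 2⁻¹ ^ n) atTop (𝓝[≠] 0) := by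
    refine tendsto_nhdsWithin_iff.2 ⟨?_, Eventually.of_forall fun n => ?_⟩
    · simpa using (tendsto_pow_atTop_nhds_zero_of_lt_one (r := (2⁻¹ : ℝ)) (by norm_num)
        (by norm_num)).const_mul s
    · have : 0 < s * 2⁻¹ ^ n := by positivity
      exact this.ne'
  exact le_of_tendsto' ((hq.comp ht).sub_const (q s)).abs fun n => key n s hs

lemma norm_le_sum_apply_single {d : ℕ} (B : Ed d →L[ℝ] Ed d →L[ℝ] ℝ) :
    ‖B‖ ≤ ∑ i, ∑ j, |B (EuclideanSpace.single i 1) (EuclideanSpace.single j 1)| := by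
  refine B.opNorm_le_bound₂ (by positivity) fun x y => ?_
  have e : B x y = ∑ i, ∑ j, x i * (y j * B (EuclideanSpace.single i 1) (EuclideanSpace.single j 1)) := by
    conv_lhs => rw [← sum_smul_single x, ← sum_smul_single y]
    simp only [map_sum, map_smul, FunLike.coe_sum, Finset.sum_apply, smul_apply, smul_eq_mul, Finset.mul_sum]
    rw [Finset.sum_comm]
    refine Finset.sum_congr rfl fun i _ => Finset.sum_congr rfl fun j _ => by ring
  rw [e, Finset.sum_mul, Finset.sum_mul]
  refine (Finset.abs_sum_le_sum_abs _ _).trans (Finset.sum_le_sum fun i _ => ?_)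
  rw [Finset.sum_mul, Finset.sum_mul]
  refine (Finset.abs_sum_le_sum_abs _ _).trans (Finset.sum_le_sum fun j _ => ?_)
  rw [abs_mul, abs_mul]
  have h1 : |x i| ≤ ‖x‖ := PiLp.norm_apply_le x i
  have h2 : |y j| ≤ ‖y‖ := PiLp.norm_apply_le y j
  calc _ ≤ ‖x‖ * (‖y‖ * |B (EuclideanSpace.single i 1) (EuclideanSpace.single j 1)|) := by gcongr
    _ = _ := by ring

/-- Constant in the bound for third differences in the velocity. -/
noncomputable def velConst (α : ℝ) : ℝ := 72 / ((2 + α) * (1 - α))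

/-- Constant in the Hölder bound of order `(2 + α) / 3` in the position. -/
noncomputable def posConst (d : ℕ) (α : ℝ) : ℝ :=
  d * (1 / (1 - 2 ^ ((2 + α) / 3) / 2) * (8 * (velConst α + 7 * (5 * 33 ^ 3))))

/-- Constant in the kinetic Hölder bound for the entries of the velocity Hessian. -/
noncomputable def hessConst (d : ℕ) (α : ℝ) : ℝ :=
  2 * (velConst α / 2 / (2 ^ α - 1)) + (d * velConst α + 12 * posConst d α + 80) / 4

lemma velConst_pos {α : ℝ} (h0 : 0 < α) (h1 : α < 1) : 0 < velConst α := by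
  have : 0 < 1 - α := by linarith
  unfold velConst
  positivity

lemma posConst_nonneg (d : ℕ) {α : ℝ} (h0 : 0 < α) (h1 : α < 1) : 0 ≤ posConst d α := by
  have hv := velConst_pos h0 h1
  have hA : 0 ≤ 1 / (1 - (2 : ℝ) ^ ((2 + α) / 3) / 2) := by
    have : (2 : ℝ) ^ ((2 + α) / 3) ≤ 2 ^ (1 : ℝ) :=
      Real.rpow_le_rpow_of_exponent_le (by norm_num) (by linarith)
    rw [Real.rpow_one] at this
    exact one_div_nonneg.2 (by linarith)
  unfold posConst
  positivity

lemma hessConst_pos (d : ℕ) {α : ℝ} (h0 : 0 < α) (h1 : α < 1) : 0 < hessConst d α := by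
  have hv := velConst_pos h0 h1
  have hp := posConst_nonneg d h0 h1
  have h2 : 0 < (2 : ℝ) ^ α - 1 := sub_pos.2 (Real.one_lt_rpow (by norm_num) h0)
  unfold hessConst
  positivity

namespace KinReg

variable {d : ℕ} {α : ℝ} {I : Set ℝ} {u : Pt d → ℝ} {M H MY K : ℝ}

lemma abs_mixedDiff_shift_le (h : KinReg α I u M H MY K) {t : ℝ} (ht : t ∈ I) (x v : Ed d)
    (i j l : Fin d) {r s : ℝ} (hr : 0 ≤ r) (hs : |s| ≤ 2 * r) :
    |mixedDiff (fun w => u (t, x, w)) (v + s • EuclideanSpace.single l 1)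
        (r • EuclideanSpace.single i 1) (r • EuclideanSpace.single j 1) -
      mixedDiff (fun w => u (t, x, w)) v
        (r • EuclideanSpace.single i 1) (r • EuclideanSpace.single j 1)| ≤
      velConst α * K * r ^ (2 + α) := by
  have := h.abs_thirdDiff_velocity_le ht x (v + (s / 2) • EuclideanSpace.single l 1) i j l
    (a := r) (b := r) (c := s / 2) (r := r) (abs_of_nonneg hr).le (abs_of_nonneg hr).le
    (by rw [abs_div, abs_two]; linarith)
  rw [thirdDiff_eq_mixedDiff_sub, add_sub_cancel_right, add_assoc, ← add_smul, add_halves] at this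
  exact this

lemma abs_mixedDiff_double_le (h : KinReg α I u M H MY K) {t : ℝ} (ht : t ∈ I) (x v : Ed d)
    (i j : Fin d) {r : ℝ} (hr : 0 ≤ r) :
    |mixedDiff (fun w => u (t, x, w)) v
        ((2 * r) • EuclideanSpace.single i 1) ((2 * r) • EuclideanSpace.single j 1) -
      4 * mixedDiff (fun w => u (t, x, w)) v
        (r • EuclideanSpace.single i 1) (r • EuclideanSpace.single j 1)| ≤
      8 * (velConst α * K * r ^ (2 + α)) := by
  have step : ∀ s s' : ℝ, |s| ≤ 2 * r → |s'| ≤ 2 * r →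
      |mixedDiff (fun w => u (t, x, w))
        (v + s • EuclideanSpace.single i 1 + s' • EuclideanSpace.single j 1)
        (r • EuclideanSpace.single i 1) (r • EuclideanSpace.single j 1) -
      mixedDiff (fun w => u (t, x, w)) v
        (r • EuclideanSpace.single i 1) (r • EuclideanSpace.single j 1)| ≤
      2 * (velConst α * K * r ^ (2 + α)) := by
    intro s s' hs hs'
    have a1 := h.abs_mixedDiff_shift_le ht x (v + s • EuclideanSpace.single i 1) i j j hr hs'
    have a2 := h.abs_mixedDiff_shift_le ht x v i j i hr hs
    exact (abs_sub_le _ _ _).trans (by linarith)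
  have hr1 : |r| ≤ 2 * r := by rw [abs_of_nonneg hr]; linarith
  have hr2 : |-r| ≤ 2 * r := by rwa [abs_neg]
  have b1 := step r r hr1 hr1
  have b2 := step r (-r) hr1 hr2
  have b3 := step (-r) r hr2 hr1
  have b4 := step (-r) (-r) hr2 hr2
  simp only [neg_smul, ← sub_eq_add_neg] at b2 b3 b4
  rw [mul_smul, mul_smul, mixedDiff_double]
  rw [abs_le] at b1 b2 b3 b4 ⊢
  constructor <;> linarith

lemma abs_hessian_sub_mixedDiff_le (h : KinReg α I u M H MY K) {t : ℝ} (ht : t ∈ I) (x v : Ed d)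
    (i j : Fin d) {r : ℝ} (hr : 0 < r) :
    |Dvv u (t, x, v) (EuclideanSpace.single i 1) (EuclideanSpace.single j 1) -
      mixedDiff (fun w => u (t, x, w)) v
        (r • EuclideanSpace.single i 1) (r • EuclideanSpace.single j 1) / (4 * r ^ 2)| ≤
      velConst α / 2 / (2 ^ α - 1) * K * r ^ α := by
  have hv := velConst_pos h.alpha_pos h.alpha_lt
  have hK := h.K_nonneg
  have lim := tendsto_mixedDiff_div (f := fun w => u (t, x, w)) (fun v => h.dv t ht x v)
    (fun v => h.dvv t ht x v) v (EuclideanSpace.single i 1) (EuclideanSpace.single j 1)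
  have := abs_sub_le_of_halving (κ := velConst α / 2 * K) h.alpha_pos (by positivity) lim
    (fun s hs => by
      have := h.abs_mixedDiff_double_le ht x v i j hs.le
      generalize mixedDiff (fun w => u (t, x, w)) v
        ((2 * s) • EuclideanSpace.single i 1) ((2 * s) • EuclideanSpace.single j 1) = a at *
      generalize mixedDiff (fun w => u (t, x, w)) v
        (s • EuclideanSpace.single i 1) (s • EuclideanSpace.single j 1) = b at *
      rw [show a / (4 * (2 * s) ^ 2) - b / (4 * s ^ 2) = (a - 4 * b) / (16 * s ^ 2) by
        field_simp; ring, abs_div, abs_of_pos (show 0 < 16 * s ^ 2 by positivity),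
        div_le_iff₀ (by positivity)]
      refine this.trans (le_of_eq ?_)
      rw [Real.rpow_add hs, Real.rpow_two]
      ring) hr
  refine this.trans (le_of_eq ?_)
  ring

lemma abs_sub_position_le_scaled (h : KinReg α I u M H MY K) {t : ℝ} (ht : t ∈ I) {x x' : Ed d}
    (v : Ed d) {r n : ℝ} (hr : 0 ≤ r) (hn : 1 ≤ n) (hx : ‖x - x'‖ ≤ n * r ^ 3) :
    |u (t, x, v) - u (t, x', v)| ≤ n * posConst d α * K * r ^ (2 + α) := by
  have hα := h.alpha_pos
  have hα1 := h.alpha_lt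
  have hK := h.K_nonneg
  have hp := posConst_nonneg d hα hα1
  have := h.abs_sub_position_le ht x' v (x - x')
  rw [add_sub_cancel] at this
  have e : (‖x - x'‖) ^ ((2 + α) / 3) ≤ n * r ^ (2 + α) := by
    calc _ ≤ (n * r ^ 3) ^ ((2 + α) / 3) := by gcongr
      _ = n ^ ((2 + α) / 3) * r ^ (2 + α) := by
        rw [Real.mul_rpow (by linarith) (by positivity), ← Real.rpow_natCast, ← Real.rpow_mul hr]
        congr 2
        push_cast
        ring
      _ ≤ n ^ (1 : ℝ) * r ^ (2 + α) := by gcongr; linarith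
      _ = _ := by rw [Real.rpow_one]
  calc _ ≤ _ := this
    _ = posConst d α * K * ‖x - x'‖ ^ ((2 + α) / 3) := by rw [posConst, velConst]; ring
    _ ≤ posConst d α * K * (n * r ^ (2 + α)) := by gcongr
    _ = _ := by ring

lemma abs_mixedDiff_sub_le (h : KinReg α I u M H MY K) {t t' : ℝ} (ht : t ∈ I) (ht' : t' ∈ I)
    (x v x' v' : Ed d) (i j : Fin d) {r : ℝ} (hr : 0 ≤ r) (h1 : |t - t'| ≤ r ^ 2)
    (h2 : ‖x - x' + (t - t') • v'‖ ≤ r ^ 3) (h3 : ‖v - v'‖ ≤ r) :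
    |mixedDiff (fun w => u (t, x, w)) v
        (r • EuclideanSpace.single i 1) (r • EuclideanSpace.single j 1) -
      mixedDiff (fun w => u (t', x', w)) v'
        (r • EuclideanSpace.single i 1) (r • EuclideanSpace.single j 1)| ≤
      (d * velConst α + 12 * posConst d α + 80) * K * r ^ (2 + α) := by
  have hK := h.K_nonneg
  obtain ⟨P, hP⟩ : ∃ P, P = K * r ^ (2 + α) := ⟨_, rfl⟩
  have velocity := abs_add_sub_le_of_coordinates (g := fun v => mixedDiff (fun w => u (t, x, w)) v
        (r • EuclideanSpace.single i 1) (r • EuclideanSpace.single j 1)) (r := r)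
    (fun v l s hs => h.abs_mixedDiff_shift_le ht x v i j l hr (by linarith)) v' (v - v') h3
  simp only [add_sub_cancel] at velocity
  have position : ∀ w, |u (t, x, w) - u (t, x' - (t - t') • v', w)| ≤ posConst d α * P := fun w => by
    have := h.abs_sub_position_le_scaled ht (x := x) (x' := x' - (t - t') • v') w hr le_rfl (by
      rw [one_mul, show x - (x' - (t - t') • v') = x - x' + (t - t') • v' by abel]
      exact h2)
    rw [hP]
    linarith
  have shear : ∀ q : Ed d, ‖q‖ ≤ 2 * r →
      |u (t, x' - (t - t') • v', v' + q) - u (t, x' - (t - t') • (v' + q), v' + q)| ≤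
      2 * posConst d α * P := fun q hq => by
    have := h.abs_sub_position_le_scaled ht (x := x' - (t - t') • v')
      (x' := x' - (t - t') • (v' + q)) (v' + q) hr (n := 2) (by norm_num) (by
      rw [show x' - (t - t') • v' - (x' - (t - t') • (v' + q)) = (t - t') • q by module, norm_smul,
        Real.norm_eq_abs]
      calc _ ≤ r ^ 2 * (2 * r) := by gcongr
        _ = _ := by ring)
    rw [hP]
    linarith
  have transport : ∀ q q' : Ed d, ‖q - q'‖ ≤ 2 * r →
      |(u (t, x' - (t - t') • (v' + q), v' + q) - u (t', x', v' + q)) -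
      (u (t, x' - (t - t') • (v' + q'), v' + q') - u (t', x', v' + q'))| ≤ 40 * P := fun q q' hq => by
    have := h.abs_transport_sub_transport_le_scaled ht' ht x' (v' + q) x' (v' + q') (n := 2) (r := r)
      (by norm_num) hr (by nlinarith) (by rw [sub_self, norm_zero]; positivity)
      (by rwa [add_sub_add_left_eq_sub])
    rw [hP]
    linarith
  have ni : ‖r • (EuclideanSpace.single i 1 : Ed d)‖ = r := by
    rw [norm_smul, PiLp.norm_single, norm_one, mul_one, Real.norm_eq_abs, abs_of_nonneg hr]
  have nj : ‖r • (EuclideanSpace.single j 1 : Ed d)‖ = r := by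
    rw [norm_smul, PiLp.norm_single, norm_one, mul_one, Real.norm_eq_abs, abs_of_nonneg hr]
  rw [mul_assoc, ← hP] at velocity ⊢
  generalize r • (EuclideanSpace.single i 1 : Ed d) = a at *
  generalize r • (EuclideanSpace.single j 1 : Ed d) = b at *
  have hab := norm_add_le a b
  have hab' := norm_sub_le a b
  have s1 := shear (a + b) (by linarith)
  have s2 := shear (a - b) (by linarith)
  have s3 := shear (-(a - b)) (by rw [norm_neg]; linarith)
  have s4 := shear (-(a + b)) (by rw [norm_neg]; linarith)
  have hbb := norm_add_le b b
  have t1 := transport (a + b) (a - b) (by rw [show a + b - (a - b) = b + b by abel]; linarith)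
  have t2 := transport (-(a - b)) (-(a + b)) (by
    rw [show -(a - b) - -(a + b) = b + b by abel]; linarith)
  have e1 : v' + (a + b) = v' + a + b := by abel
  have e2 : v' + (a - b) = v' + a - b := by abel
  have e3 : v' + -(a - b) = v' - a + b := by abel
  have e4 : v' + -(a + b) = v' - a - b := by abel
  rw [e1, e2] at t1
  rw [e3, e4] at t2
  rw [e1] at s1
  rw [e2] at s2
  rw [e3] at s3
  rw [e4] at s4
  have p1 := position (v' + a + b)
  have p2 := position (v' + a - b)
  have p3 := position (v' - a + b)
  have p4 := position (v' - a - b)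
  have goal2 : |mixedDiff (fun w => u (t, x, w)) v' a b - mixedDiff (fun w => u (t', x', w)) v' a b|
      ≤ (12 * posConst d α + 80) * P := by
    simp only [mixedDiff]
    rw [abs_le] at p1 p2 p3 p4 s1 s2 s3 s4 t1 t2 ⊢
    constructor <;> linarith
  refine (abs_sub_le _ _ _).trans ((add_le_add velocity goal2).trans (le_of_eq ?_))
  ring

theorem norm_hessian_sub_le (h : KinReg α I u M H MY K) {z z' : Pt d} (hz : z.1 ∈ I)
    (hz' : z'.1 ∈ I) (hρ : 0 < kRho z z') :
    ‖Dvv u z - Dvv u z'‖ ≤ d * (d * hessConst d α) * K * kRho z z' ^ α := by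
  obtain ⟨t, x, v⟩ := z
  obtain ⟨t', x', v'⟩ := z'
  simp only at hz hz'
  have h1 : |t - t'| ≤ kRho (t, x, v) (t', x', v') ^ 2 := by
    have : |t - t'| ^ ((1 : ℝ) / 2) ≤ kRho (t, x, v) (t', x', v') := le_max_left _ _
    have := pow_le_pow_left₀ (by positivity) this 2
    rwa [← Real.rpow_natCast, ← Real.rpow_mul (abs_nonneg _), Nat.cast_ofNat,
      show (1 : ℝ) / 2 * 2 = 1 by norm_num, Real.rpow_one] at this
  have h2 : ‖x - x' + (t - t') • v'‖ ≤ kRho (t, x, v) (t', x', v') ^ 3 := by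
    have : ‖x - x' + (t - t') • v'‖ ^ ((1 : ℝ) / 3) ≤ kRho (t, x, v) (t', x', v') :=
      (le_max_left _ _).trans (le_max_right _ _)
    have := pow_le_pow_left₀ (by positivity) this 3
    rwa [← Real.rpow_natCast, ← Real.rpow_mul (norm_nonneg _), Nat.cast_ofNat,
      show (1 : ℝ) / 3 * 3 = 1 by norm_num, Real.rpow_one] at this
  have h3 : ‖v - v'‖ ≤ kRho (t, x, v) (t', x', v') :=
    (le_max_right _ _).trans (le_max_right _ _)
  generalize kRho (t, x, v) (t', x', v') = r at *
  refine (norm_le_sum_apply_single _).trans ?_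
  have entry : ∀ i j, |(Dvv u (t, x, v) - Dvv u (t', x', v')) (EuclideanSpace.single i 1)
      (EuclideanSpace.single j 1)| ≤ hessConst d α * K * r ^ α := by
    intro i j
    have a1 := h.abs_hessian_sub_mixedDiff_le hz x v i j hρ
    have a2 := h.abs_hessian_sub_mixedDiff_le hz' x' v' i j hρ
    have a3 := h.abs_mixedDiff_sub_le hz hz' x v x' v' i j hρ.le h1 h2 h3
    have a4 : |mixedDiff (fun w => u (t, x, w)) v (r • EuclideanSpace.single i 1)
          (r • EuclideanSpace.single j 1) / (4 * r ^ 2) -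
        mixedDiff (fun w => u (t', x', w)) v' (r • EuclideanSpace.single i 1)
          (r • EuclideanSpace.single j 1) / (4 * r ^ 2)| ≤
        (d * velConst α + 12 * posConst d α + 80) / 4 * K * r ^ α := by
      rw [← sub_div, abs_div, abs_of_pos (show 0 < 4 * r ^ 2 by positivity),
        div_le_iff₀ (by positivity)]
      refine a3.trans (le_of_eq ?_)
      rw [Real.rpow_add hρ, Real.rpow_two]
      ring
    rw [sub_apply, sub_apply, hessConst]
    rw [abs_le] at a1 a2 a4 ⊢
    constructor <;> linarith
  calc _ ≤ ∑ _i : Fin d, ∑ _j : Fin d, hessConst d α * K * r ^ α :=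
        Finset.sum_le_sum fun i _ => Finset.sum_le_sum fun j _ => entry i j
    _ = _ := by
      simp only [Finset.sum_const, Finset.card_univ, Fintype.card_fin, nsmul_eq_mul]
      ring

theorem abs_sub_le_kRho (h : KinReg α I u M H MY K) {z z' : Pt d} (hz : z.1 ∈ I)
    (hz' : z'.1 ∈ I) (hρ : 0 < kRho z z') :
    |u z - u z'| ≤ (2 * M + 2 * H + MY) * kRho z z' ^ α := by
  obtain ⟨t, x, v⟩ := z
  obtain ⟨t', x', v'⟩ := z'
  simp only at hz hz'
  have h1 : |t - t'| ≤ kRho (t, x, v) (t', x', v') ^ 2 := by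
    have : |t - t'| ^ ((1 : ℝ) / 2) ≤ kRho (t, x, v) (t', x', v') := le_max_left _ _
    have := pow_le_pow_left₀ (by positivity) this 2
    rwa [← Real.rpow_natCast, ← Real.rpow_mul (abs_nonneg _), Nat.cast_ofNat,
      show (1 : ℝ) / 2 * 2 = 1 by norm_num, Real.rpow_one] at this
  have h2 : ‖x - x' + (t - t') • v'‖ ^ ((1 : ℝ) / 3) ≤ kRho (t, x, v) (t', x', v') :=
    (le_max_left _ _).trans (le_max_right _ _)
  have h3 : ‖v - v'‖ ≤ kRho (t, x, v) (t', x', v') :=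
    (le_max_right _ _).trans (le_max_right _ _)
  generalize kRho (t, x, v) (t', x', v') = r at *
  have hα := h.alpha_pos
  have hα1 := h.alpha_lt
  have hH := h.H_nonneg
  have hMY : 0 ≤ MY := (abs_nonneg _).trans (h.bound_Y t hz x v)
  have hM : 0 ≤ M := (abs_nonneg _).trans (h.bound t hz x v)
  rcases le_total r 1 with hr | hr
  · have a1 := h.abs_transport_le hz' hz x' v'
    have a2 := h.holder t hz x v (x' - (t - t') • v') v'
    rw [show x - (x' - (t - t') • v') = x - x' + (t - t') • v' by abel] at a2
    have a3 : (‖x - x' + (t - t') • v'‖ ^ ((1 : ℝ) / 3) + ‖v - v'‖) ^ α ≤ 2 * r ^ α := by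
      calc _ ≤ (2 * r) ^ α := by gcongr; linarith
        _ = 2 ^ α * r ^ α := Real.mul_rpow (by norm_num) hρ.le
        _ ≤ 2 ^ (1 : ℝ) * r ^ α := by gcongr; norm_num
        _ = _ := by rw [Real.rpow_one]
    have a4 : r ^ 2 ≤ r ^ α := by
      rw [← Real.rpow_two]
      exact Real.rpow_le_rpow_of_exponent_ge hρ hr (by linarith)
    calc _ ≤ _ := abs_sub_le _ _ _
      _ ≤ H * (2 * r ^ α) + MY * r ^ α :=
        add_le_add (a2.trans (by gcongr)) (a1.trans (by gcongr; exact h1.trans a4))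
      _ ≤ 2 * M * r ^ α + (H * (2 * r ^ α) + MY * r ^ α) := le_add_of_nonneg_left (by positivity)
      _ = _ := by ring
  · have a1 := abs_le.1 (h.bound t hz x v)
    have a2 := abs_le.1 (h.bound t' hz' x' v')
    have a3 : 1 ≤ r ^ α := Real.one_le_rpow hr hα.le
    calc _ ≤ 2 * M := abs_le.2 ⟨by linarith, by linarith⟩
      _ ≤ 2 * M + 2 * H + MY := by linarith
      _ ≤ _ := le_mul_of_one_le_right (by positivity) a3

end KinReg

lemma kRho_pos {d : ℕ} {z z' : Pt d} (h : z ≠ z') : 0 < kRho z z' := by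
  obtain ⟨t, x, v⟩ := z
  obtain ⟨t', x', v'⟩ := z'
  rw [kRho, lt_max_iff, lt_max_iff]
  by_contra! hc
  obtain ⟨h1, h2, h3⟩ := hc
  have e1 : t = t' := by
    by_contra hne
    exact absurd h1 (not_le.2 (Real.rpow_pos_of_pos (abs_pos.2 (sub_ne_zero.2 hne)) _))
  have e3 : v = v' := sub_eq_zero.1 (norm_le_zero_iff.1 h3)
  subst e1 e3
  have e2 : x = x' := by
    by_contra hne
    refine absurd h2 (not_le.2 (Real.rpow_pos_of_pos ?_ _))
    simpa [sub_eq_zero] using hne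
  exact h (by rw [e2])

lemma norm_le_toReal_supNorm {d : ℕ} {F : Type*} [NormedAddCommGroup F] {G : Set (Pt d)}
    {w : Pt d → F} (h : supNorm G w < ⊤) {z : Pt d} (hz : z ∈ G) : ‖w z‖ ≤ (supNorm G w).toReal := by
  have h1 : (‖w z‖₊ : ℝ≥0∞) ≤ supNorm G w :=
    le_iSup₂ (f := fun (z : Pt d) (_ : z ∈ G) => (‖w z‖₊ : ℝ≥0∞)) z hz
  simpa using ENNReal.toReal_mono h.ne h1

lemma norm_sub_le_toReal_lixvSemi {d : ℕ} {F : Type*} [NormedAddCommGroup F] {α : ℝ} {I : Set ℝ}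
    {w : Pt d → F} (h : lixvSemi α I univ w < ⊤) {t : ℝ} (ht : t ∈ I) (x v x' v' : Ed d) :
    ‖w (t, x, v) - w (t, x', v')‖ ≤
      (lixvSemi α I univ w).toReal * (‖x - x'‖ ^ ((1 : ℝ) / 3) + ‖v - v'‖) ^ α := by
  by_cases hne : ((x, v) : Ed d × Ed d) = (x', v')
  · obtain ⟨rfl, rfl⟩ := Prod.mk.inj hne
    simp only [sub_self, norm_zero]
    positivity
  have h1 : ENNReal.ofReal (‖w (t, x, v) - w (t, x', v')‖ /
      (‖x - x'‖ ^ ((1 : ℝ) / 3) + ‖v - v'‖) ^ α) ≤ lixvSemi α I univ w := by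
    refine le_trans ?_ (le_iSup₂ (f := fun (t : ℝ) (_ : t ∈ I) =>
      anisoSemi α univ (fun p => w (t, p.1, p.2))) t ht)
    exact le_iSup_of_le (x, v) (le_iSup_of_le (mem_univ _) (le_iSup_of_le (x', v')
      (le_iSup_of_le (mem_univ _) (le_iSup_of_le hne le_rfl))))
  have hpos : 0 < ‖x - x'‖ ^ ((1 : ℝ) / 3) + ‖v - v'‖ := by
    by_cases hx : x = x'
    · have hv : v ≠ v' := fun hv => hne (by rw [hx, hv])
      have := norm_pos_iff.2 (sub_ne_zero.2 hv)
      positivity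
    · have := Real.rpow_pos_of_pos (norm_pos_iff.2 (sub_ne_zero.2 hx)) ((1 : ℝ) / 3)
      positivity
  rw [← div_le_iff₀ (Real.rpow_pos_of_pos hpos _)]
  exact (ENNReal.ofReal_le_iff_le_toReal h.ne).1 h1

lemma lixvSemi_le {d : ℕ} {F : Type*} [NormedAddCommGroup F] {α C : ℝ} {I : Set ℝ}
    {w : Pt d → F} (hC : 0 ≤ C) (h : ∀ t ∈ I, ∀ x v x' v', ‖w (t, x, v) - w (t, x', v')‖ ≤
      C * (‖x - x'‖ ^ ((1 : ℝ) / 3) + ‖v - v'‖) ^ α) :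
    lixvSemi α I univ w ≤ ENNReal.ofReal C := by
  refine iSup₂_le fun t ht => iSup₂_le fun p _ => iSup₂_le fun q _ => iSup_le fun _ =>
    ENNReal.ofReal_le_ofReal ?_
  exact div_le_of_le_mul₀ (by positivity) hC (h t ht _ _ _ _)

lemma kSemi_le {d : ℕ} {F : Type*} [NormedAddCommGroup F] {α C : ℝ} {G : Set (Pt d)}
    {w : Pt d → F}
    (h : ∀ z ∈ G, ∀ z' ∈ G, 0 < kRho z z' → ‖w z - w z'‖ ≤ C * kRho z z' ^ α) :
    kSemi α G w ≤ ENNReal.ofReal C := by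
  refine iSup₂_le fun z hz => iSup₂_le fun z' hz' => iSup_le fun hne =>
    ENNReal.ofReal_le_ofReal ?_
  have := kRho_pos hne
  rw [div_le_iff₀ (by positivity)]
  exact h z hz z' hz' this

lemma abs_lapV_sub_le {d : ℕ} (u : Pt d → ℝ) (z z' : Pt d) :
    |lapV u z - lapV u z'| ≤ d * ‖Dvv u z - Dvv u z'‖ := by
  rw [lapV, lapV, ← Finset.sum_sub_distrib]
  refine (Finset.abs_sum_le_sum_abs _ _).trans ((Finset.sum_le_card_nsmul _ _
    ‖Dvv u z - Dvv u z'‖ fun i _ => ?_).trans (by simp))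
  have := (Dvv u z - Dvv u z').le_opNorm₂ (EuclideanSpace.single i 1) (EuclideanSpace.single i 1)
  simpa using this

lemma lixvSemi_lapV_lt_top {d : ℕ} {α : ℝ} {I : Set ℝ} {u : Pt d → ℝ}
    (h : lixvSemi α I univ (Dvv u) < ⊤) : lixvSemi α I univ (lapV u) < ⊤ := by
  refine (lixvSemi_le (C := d * (lixvSemi α I univ (Dvv u)).toReal) (by positivity)
    fun t ht x v x' v' => (abs_lapV_sub_le u _ _).trans ?_).trans_lt ENNReal.ofReal_lt_top
  rw [mul_assoc]
  gcongr
  exact norm_sub_le_toReal_lixvSemi h ht x v x' v'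

lemma exists_pos_add_mem_slabI {T : EReal} {t : ℝ} (ht : t ∈ slabI T) :
    ∃ δ, 0 < δ ∧ t + δ ∈ slabI T := by
  obtain ⟨s, hs, hsT⟩ := EReal.lt_iff_exists_real_btwn.1 (show (t : EReal) < T from ht)
  refine ⟨s - t, sub_pos.2 (EReal.coe_lt_coe_iff.1 hs), ?_⟩
  rw [add_sub_cancel]
  exact hsT

/-- Functions in the anisotropic Hölder space satisfy quantitative real-valued bounds. -/
lemma C2mem.kinReg {d : ℕ} {α : ℝ} (hα : α ∈ Set.Ioo (0 : ℝ) 1) {T : EReal} {u : Pt d → ℝ}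
    (h : C2mem α (slabI T) univ u) :
    KinReg α (slabI T) u (supNorm (slabI T ×ˢ univ) u).toReal
      (lixvSemi α (slabI T) univ u).toReal (supNorm (slabI T ×ˢ univ) (Yop u)).toReal
      ((lixvSemi α (slabI T) univ (Yop u)).toReal +
        (lixvSemi α (slabI T) univ (lapV u)).toReal) := by
  obtain ⟨ht, hx, hv, hvv, hu, hu', -, -, -, hD, hY, hY'⟩ := h
  have hm : ∀ t ∈ slabI T, ∀ x v : Ed d, (t, x, v) ∈ slabI T ×ˢ (univ : Set (Ed d × Ed d)) :=
    fun t h x v => ⟨h, mem_univ _⟩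
  refine ⟨hα.1, hα.2, fun t ht s hs => (EReal.coe_le_coe_iff.2 hs).trans_lt ht,
    fun t ht => exists_pos_add_mem_slabI ht, by positivity, by positivity,
    fun t h x v => ht _ (hm t h x v), fun t h x v => hx _ (hm t h x v),
    fun t h x v => hv _ (hm t h x v), fun t h x v => hvv _ (hm t h x v),
    fun t h x v => norm_le_toReal_supNorm hu (hm t h x v),
    fun t h x v x' v' => norm_sub_le_toReal_lixvSemi hu' h x v x' v',
    fun t h x v => norm_le_toReal_supNorm hY (hm t h x v), fun t h x v x' v' => ?_,
    fun t h x v x' v' => ?_⟩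
  · refine (norm_sub_le_toReal_lixvSemi hY' h x v x' v').trans ?_
    gcongr
    exact le_add_of_nonneg_right (by positivity)
  · refine (norm_sub_le_toReal_lixvSemi (lixvSemi_lapV_lt_top hD) h x v x' v').trans ?_
    gcongr
    exact le_add_of_nonneg_left (by positivity)

end

open MeasureTheory ENNReal Set in
/-- **Corollary 1.8 (i)**: global inclusion `ℂ^{2,α} ⊂ kC^{2,α}`. -/
theorem C2_subset_kC2 (d : ℕ) (hd : 1 ≤ d) (α : ℝ) (hα : α ∈ Set.Ioo (0:ℝ) 1) :
    ∃ N : ℝ, 0 < N ∧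
      ∀ T : EReal, ⊥ < T → ∀ u : Pt d → ℝ, C2mem α (slabI T) Set.univ u →
        kC2mem α (slabI T) Set.univ u ∧
        kSemi α (slabG d T) (Dvv u) ≤
          ENNReal.ofReal N *
            (lixvSemi α (slabI T) Set.univ (Yop u) +
              lixvSemi α (slabI T) Set.univ (lapV u)) := by
  have hN := hessConst_pos d hα.1 hα.2
  refine ⟨d * (d * hessConst d α), by positivity, fun T _ u hu => ?_⟩
  have hK := hu.kinReg hα
  obtain ⟨ht, hx, hv, hvv, hu0, -, -, -, -, hD, hY, hY'⟩ := hu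
  have hL := lixvSemi_lapV_lt_top hD
  have key : kSemi α (slabG d T) (Dvv u) ≤ ENNReal.ofReal (d * (d * hessConst d α)) *
      (lixvSemi α (slabI T) Set.univ (Yop u) + lixvSemi α (slabI T) Set.univ (lapV u)) := by
    refine (kSemi_le fun z hz z' hz' hρ =>
      hK.norm_hessian_sub_le hz.1 hz'.1 hρ).trans_eq ?_
    rw [ENNReal.ofReal_mul (by positivity), ENNReal.ofReal_add (by positivity) (by positivity),
      ENNReal.ofReal_toReal hY'.ne, ENNReal.ofReal_toReal hL.ne]
  refine ⟨⟨hu0, ?_, ht, hx, hv, hvv, hY, hY', key.trans_lt ?_⟩, key⟩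
  · exact (kSemi_le fun z hz z' hz' hρ =>
      hK.abs_sub_le_kRho hz.1 hz'.1 hρ).trans_lt ENNReal.ofReal_lt_top
  · exact ENNReal.mul_lt_top ENNReal.ofReal_lt_top (ENNReal.add_lt_top.2 ⟨hY', hL⟩)
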